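/- For every real x > 0, with q = e^{−πx/√12}, one has F(1,1,1,x²)/(3+x²)² = (π²/(24√3·x)) · Im( ∫ ∏_{n=1}^∞ (1−u^{3n})⁹ / ∏_{n=1}^∞ (1−u^{n})³ du ), where the integral is taken over the straight line segment in ℂ from 0 to i·q. -/

import Mathlib

open Real Filter Topology

/-- The partial "box" sum appearing in the definition of the lattice sum `F(a,b,c,d)`. -/
noncomputable def boxSum (a b c d : ℝ) (v : ℕ) : ℝ :=
  ∑ n₁ ∈ Finset.Icc (-(v:ℤ)) (v:ℤ), ∑ n₂ ∈ Finset.Icc (-(v:ℤ)) (v:ℤ),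
    ∑ n₃ ∈ Finset.Icc (-(v:ℤ)) (v:ℤ), ∑ n₄ ∈ Finset.Icc (-(v:ℤ)) (v:ℤ),
      (-1:ℝ)^(n₁+n₂+n₃+n₄) /
        (a*((6*n₁+1:ℤ):ℝ)^2 + b*((6*n₂+1:ℤ):ℝ)^2 + c*((6*n₃+1:ℤ):ℝ)^2 + d*((6*n₄+1:ℤ):ℝ)^2)^2

/-- Ramanujan's function `f(-q) = ∏_{n≥1} (1 - qⁿ)`, for complex `|q| < 1`. -/
noncomputable def fC (q : ℂ) : ℂ := ∏' n : ℕ, (1 - q^(n+1))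

/-- The Gaussian binomial coefficient evaluated at `q`. -/
noncomputable def gaussBinom (q : ℂ) : ℕ → ℕ → ℂ
  | _, 0 => 1
  | 0, _ + 1 => 0
  | M + 1, j + 1 => gaussBinom q M j + q ^ (j + 1) * gaussBinom q M (j + 1)

lemma gaussBinom_zero_right (q : ℂ) (M : ℕ) : gaussBinom q M 0 = 1 := by
  cases M <;> rfl

lemma gaussBinom_eq_zero_of_lt (q : ℂ) (M : ℕ) : ∀ j, M < j → gaussBinom q M j = 0 := by
  induction M with
  | zero => intro j hj; obtain ⟨k, rfl⟩ := Nat.exists_eq_succ_of_ne_zero hj.ne'; rfl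
  | succ M ih =>
    intro j hj
    obtain ⟨k, rfl⟩ := Nat.exists_eq_succ_of_ne_zero (Nat.ne_zero_of_lt hj)
    simp [gaussBinom, ih k (by omega), ih (k + 1) (by omega)]

lemma prod_one_add_pow_mul (q : ℂ) (M : ℕ) : ∀ y : ℂ, ∏ k ∈ Finset.range M, (1 + q ^ k * y) =
    ∑ j ∈ Finset.range (M + 1), q ^ (j.choose 2) * gaussBinom q M j * y ^ j := by
  induction M with
  | zero => intro y; simp [gaussBinom_zero_right]
  | succ M ih =>
    intro y
    have h1 : ∏ k ∈ Finset.range M, (1 + q ^ (k + 1) * y) =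
        ∏ k ∈ Finset.range M, (1 + q ^ k * (q * y)) :=
      Finset.prod_congr rfl fun k _ => by ring
    rw [Finset.prod_range_succ', h1, ih, Finset.sum_range_succ' _ (M + 1)]
    have h2 : ∀ j, q ^ ((j + 1).choose 2) * gaussBinom q (M + 1) (j + 1) * y ^ (j + 1) =
        q ^ (j.choose 2) * gaussBinom q M j * (q * y) ^ j * y +
        q ^ ((j + 1).choose 2) * gaussBinom q M (j + 1) * (q * y) ^ (j + 1) := by
      intro j
      have : (j + 1).choose 2 = j + j.choose 2 := by
        rw [Nat.choose_succ_succ' j 1, Nat.choose_one_right]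
      rw [this, gaussBinom]; ring
    simp only [h2, Finset.sum_add_distrib]
    rw [Finset.sum_range_succ (fun j => q ^ ((j + 1).choose 2) * gaussBinom q M (j + 1) *
      (q * y) ^ (j + 1)) M, gaussBinom_eq_zero_of_lt q M (M + 1) (by omega)]
    have h3 := Finset.sum_range_succ' (fun j => q ^ (j.choose 2) * gaussBinom q M j *
      (q * y) ^ j) M
    rw [← Finset.sum_mul, h3, gaussBinom_zero_right, gaussBinom_zero_right]
    ring

lemma gaussBinom_mul_prod (q : ℂ) (M : ℕ) : ∀ j k, j + k = M →
    gaussBinom q M j * ((∏ i ∈ Finset.range j, (1 - q ^ (i + 1))) *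
      ∏ i ∈ Finset.range k, (1 - q ^ (i + 1))) = ∏ i ∈ Finset.range M, (1 - q ^ (i + 1)) := by
  induction M with
  | zero => 
    intro j k h
    obtain ⟨rfl, rfl⟩ : j = 0 ∧ k = 0 := by omega
    simp [gaussBinom]
  | succ M ih =>
    intro j k h
    rcases j with _ | j
    · obtain rfl : k = M + 1 := by omega
      simp [gaussBinom]
    · rw [gaussBinom, Finset.prod_range_succ _ M, ← ih j k (by omega)]
      rcases k with _ | k
      · obtain rfl : j = M := by omega
        rw [gaussBinom_eq_zero_of_lt q j (j + 1) (by omega), Finset.prod_range_succ _ j]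
        ring
      · have h2 := ih (j + 1) k (by omega)
        rw [← ih j (k + 1) (by omega), Finset.prod_range_succ _ j] at h2
        rw [Finset.prod_range_succ _ j]
        obtain rfl : M = j + (k + 1) := by omega
        rw [Finset.prod_range_succ _ k] at h2 ⊢
        linear_combination q ^ (j + 1) * (1 - q ^ (k + 1)) * h2

/-- The triangular numbers `n (n - 1) / 2`, indexed by the integers. -/
def tri (n : ℤ) : ℤ := n * (n - 1) / 2

lemma two_mul_tri (n : ℤ) : 2 * tri n = n * (n - 1) :=
  Int.mul_ediv_cancel' (Int.even_mul_pred_self n).two_dvd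

lemma natCast_choose_two (j : ℕ) : ((j.choose 2 : ℕ) : ℤ) = tri j := by
  have h1 := two_mul_tri j
  have h2 : ((j.choose 2 : ℕ) : ℤ) * 2 = j * (j - 1) := by
    induction j with
    | zero => simp
    | succ j ih =>
      rw [Nat.choose_succ_succ' j 1, Nat.choose_one_right]
      push_cast
      linarith [ih (two_mul_tri j)]
  linarith

lemma prod_one_sub_eq_sum (q x : ℂ) (hq : q ≠ 0) (hx : x ≠ 0) (N : ℕ) :
    (∏ i ∈ Finset.range N, (1 - q ^ i * x)) * ∏ i ∈ Finset.range N, (1 - q ^ (i + 1) * x⁻¹) =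
    ∑ j ∈ Finset.range (2 * N + 1), (-1) ^ ((j : ℤ) - N) * q ^ tri ((j : ℤ) - N) *
      x ^ ((j : ℤ) - N) * gaussBinom q (2 * N) j := by
  have key := prod_one_add_pow_mul q (2 * N) (-x * q ^ (-(N : ℤ)))
  rw [two_mul N, Finset.prod_range_add, ← Finset.prod_range_reflect, ← two_mul] at key
  have h1 : ∀ i ∈ Finset.range N, (1 + q ^ (N - 1 - i) * (-x * q ^ (-(N : ℤ)))) =
      (-x * q ^ (-((i : ℤ) + 1))) * (1 - q ^ (i + 1) * x⁻¹) := by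
    intro i hi
    have hi' := Finset.mem_range.mp hi
    have e1 : q ^ (N - 1 - i) = q ^ (N : ℤ) * q ^ (-((i : ℤ) + 1)) := by
      rw [← zpow_natCast, ← zpow_add₀ hq]; congr 1; omega
    have e2 : q ^ (i + 1) = (q ^ (-((i : ℤ) + 1)))⁻¹ := by
      rw [zpow_neg, inv_inv]; norm_cast
    have e3 : q ^ (-((i : ℤ) + 1)) ≠ 0 := zpow_ne_zero _ hq
    have e4 : q ^ (N : ℤ) ≠ 0 := zpow_ne_zero _ hq
    rw [e1, e2, zpow_neg q N]
    field_simp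
    ring
  have h2 : ∀ i ∈ Finset.range N, (1 + q ^ (N + i) * (-x * q ^ (-(N : ℤ)))) =
      1 - q ^ i * x := by
    intro i _
    have e4 : q ^ N ≠ 0 := pow_ne_zero _ hq
    rw [zpow_neg, zpow_natCast, pow_add]
    field_simp
    ring
  have h3 : ∏ i ∈ Finset.range N, (-x * q ^ (-((i : ℤ) + 1))) =
      (-x) ^ (N : ℤ) * q ^ (-tri (N + 1)) := by
    clear key h1 h2
    induction N with
    | zero => simp [tri]
    | succ N ih =>
      rw [Finset.prod_range_succ, ih]
      have : -tri ((N + 1 : ℕ) + 1) = -tri (N + 1) + -((N : ℤ) + 1) := by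
        have a1 := two_mul_tri (N + 1)
        have a2 := two_mul_tri ((N + 1 : ℕ) + 1)
        push_cast at a2 ⊢
        linarith
      rw [this, zpow_add₀ hq, Nat.cast_succ, zpow_add₀ (neg_ne_zero.mpr hx)]
      simp
      ring
  rw [Finset.prod_congr rfl h1, Finset.prod_congr rfl h2, Finset.prod_mul_distrib, h3] at key
  have hne : (-x) ^ (N : ℤ) * q ^ (-tri (N + 1)) ≠ 0 :=
    mul_ne_zero (zpow_ne_zero _ (neg_ne_zero.mpr hx)) (zpow_ne_zero _ hq)
  apply mul_left_cancel₀ hne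
  rw [← mul_assoc, mul_right_comm, key, Finset.mul_sum]
  refine Finset.sum_congr rfl fun j _ => ?_
  rw [← zpow_natCast q (j.choose 2), natCast_choose_two, mul_pow, ← zpow_natCast (q ^ (-(N : ℤ))),
    ← zpow_mul, ← zpow_natCast (-x)]
  have e1 : (-x) ^ (j : ℤ) = (-x) ^ (N : ℤ) * ((-1) ^ ((j : ℤ) - N) * x ^ ((j : ℤ) - N)) := by
    rw [← mul_zpow, neg_one_mul, ← zpow_add₀ (neg_ne_zero.mpr hx)]; congr 1; omega
  have e2 : q ^ tri j * q ^ (-(N : ℤ) * j) = q ^ (-tri (N + 1)) * q ^ tri ((j : ℤ) - N) := by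
    rw [← zpow_add₀ hq, ← zpow_add₀ hq]; congr 1
    have a1 := two_mul_tri (N + 1)
    have a2 := two_mul_tri j
    have a3 := two_mul_tri (j - N)
    linarith
  rw [e1]
  linear_combination (-x) ^ (N : ℤ) * ((-1) ^ ((j : ℤ) - N) * x ^ ((j : ℤ) - N)) *
    gaussBinom q (2 * N) j * e2

lemma summable_zpow_mul_exp_abs {ρ : ℝ} (h0 : 0 < ρ) (h1 : ρ < 1) {g : ℤ → ℤ}
    (hg : ∀ n, n ^ 2 - |n| ≤ 2 * g n) (r : ℝ) :
    Summable fun n : ℤ => ρ ^ g n * exp (r * |(n : ℝ)|) := by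
  set s := -Real.log ρ with hs
  have hs0 : 0 < s := by have := Real.log_neg h0 h1; linarith
  have key := summable_pow_mul_jacobiTheta₂_term_bound ((s / 2 + r) / (2 * π))
    (T := s / (2 * π)) (by positivity) 0
  refine key.of_nonneg_of_le (fun n => by positivity) fun n => ?_
  have e1 : ρ ^ g n = exp (-s * g n) := by
    rw [← Real.rpow_intCast, Real.rpow_def_of_pos h0, hs, neg_neg]
  rw [e1, ← Real.exp_add, pow_zero, one_mul]
  apply Real.exp_le_exp.mpr
  have h2 : ((n : ℝ) ^ 2 - |(n : ℝ)|) ≤ 2 * (g n : ℝ) := by exact_mod_cast hg n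
  have : -π * (s / (2 * π) * (n : ℝ) ^ 2 - 2 * ((s / 2 + r) / (2 * π)) * |(n : ℝ)|) =
      -s * ((n : ℝ) ^ 2 - |(n : ℝ)|) / 2 + r * |(n : ℝ)| := by
    field_simp; ring
  rw [Int.cast_abs, this]
  nlinarith

lemma sq_sub_abs_le_two_mul_tri (n : ℤ) : n ^ 2 - |n| ≤ 2 * tri n := by
  rw [two_mul_tri]; nlinarith [le_abs_self n]

lemma norm_zpow_le_exp {x : ℂ} (hx : x ≠ 0) (n : ℤ) :
    ‖x ^ n‖ ≤ exp (|Real.log ‖x‖| * |(n : ℝ)|) := by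
  rw [norm_zpow, ← Real.rpow_intCast, Real.rpow_def_of_pos (norm_pos_iff.mpr hx), ← abs_mul]
  exact Real.exp_le_exp.mpr (le_abs_self _)

lemma summable_neg_pow {q : ℂ} (hq : ‖q‖ < 1) (a : ℂ) : Summable fun n : ℕ => ‖-(q ^ n * a)‖ := by
  simp only [norm_neg, norm_mul, norm_pow]
  exact (summable_geometric_of_lt_one (norm_nonneg _) hq).mul_right _

/-- The infinite `q`-Pochhammer symbol `(a; q)_∞`. -/
noncomputable def qPoch (q a : ℂ) : ℂ := ∏' n : ℕ, (1 - q ^ n * a)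

lemma tendsto_qPoch {q : ℂ} (hq : ‖q‖ < 1) (a : ℂ) :
    Tendsto (fun N => ∏ i ∈ Finset.range N, (1 - q ^ i * a)) atTop (𝓝 (qPoch q a)) := by
  have := (multipliable_one_add_of_summable (summable_neg_pow hq a)).hasProd.tendsto_prod_nat
  simpa only [qPoch, ← sub_eq_add_neg] using this

lemma fC_eq_qPoch (q : ℂ) : fC q = qPoch q q := by simp [fC, qPoch, pow_succ]

lemma tendsto_fC {q : ℂ} (hq : ‖q‖ < 1) :
    Tendsto (fun N => ∏ i ∈ Finset.range N, (1 - q ^ (i + 1))) atTop (𝓝 (fC q)) := by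
  simpa [fC_eq_qPoch, pow_succ] using tendsto_qPoch hq q

lemma one_sub_pow_succ_ne_zero {q : ℂ} (hq : ‖q‖ < 1) (n : ℕ) : 1 - q ^ (n + 1) ≠ 0 := by
  intro h
  have : ‖q ^ (n + 1)‖ = 1 := by rw [← sub_eq_zero.mp h, norm_one]
  rw [norm_pow] at this
  exact (pow_lt_one₀ (norm_nonneg _) hq n.succ_ne_zero).ne this

lemma fC_ne_zero {q : ℂ} (hq : ‖q‖ < 1) : fC q ≠ 0 := by
  have := tprod_one_add_ne_zero_of_summable (f := fun n : ℕ => -(q ^ n * q))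
    (fun n => by simpa [sub_eq_add_neg, pow_succ] using one_sub_pow_succ_ne_zero hq n)
    (summable_neg_pow hq q)
  simpa [fC, sub_eq_add_neg, pow_succ] using this

lemma exists_norm_gaussBinom_le {q : ℂ} (hq : ‖q‖ < 1) :
    ∃ C : ℝ, ∀ M j, ‖gaussBinom q M j‖ ≤ C := by
  set P : ℕ → ℂ := fun N => ∏ i ∈ Finset.range N, (1 - q ^ (i + 1)) with hP
  have hP0 : ∀ N, P N ≠ 0 := fun N =>
    Finset.prod_ne_zero_iff.mpr fun i _ => one_sub_pow_succ_ne_zero hq i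
  obtain ⟨A, hA⟩ := (tendsto_fC hq).norm.bddAbove_range
  obtain ⟨B, hB⟩ := ((tendsto_fC hq).inv₀ (fC_ne_zero hq)).norm.bddAbove_range
  have hA' : ∀ N, ‖P N‖ ≤ A := fun N => hA ⟨N, rfl⟩
  have hB' : ∀ N, ‖(P N)⁻¹‖ ≤ B := fun N => hB ⟨N, rfl⟩
  have hA0 : 0 ≤ A := (norm_nonneg _).trans (hA' 0)
  have hB0 : 0 ≤ B := (norm_nonneg _).trans (hB' 0)
  refine ⟨A * (B * B), fun M j => ?_⟩
  rcases lt_or_ge M j with h | h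
  · rw [gaussBinom_eq_zero_of_lt q M j h, norm_zero]; positivity
  · have := gaussBinom_mul_prod q M j (M - j) (by omega)
    have e : gaussBinom q M j = P M * ((P j)⁻¹ * (P (M - j))⁻¹) := by
      have h1 := hP0 j
      have h2 := hP0 (M - j)
      simp only [hP] at h1 h2 ⊢
      rw [← this]; field_simp
    rw [e, norm_mul, norm_mul]
    gcongr
    exacts [hA' _, hB' _, hB' _]

lemma tendsto_gaussBinom {q : ℂ} (hq : ‖q‖ < 1) (n : ℤ) :
    Tendsto (fun N : ℕ => gaussBinom q (2 * N) (n + N).toNat) atTop (𝓝 (fC q)⁻¹) := by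
  set P : ℕ → ℂ := fun N => ∏ i ∈ Finset.range N, (1 - q ^ (i + 1)) with hP
  have hP0 : ∀ N, P N ≠ 0 := fun N =>
    Finset.prod_ne_zero_iff.mpr fun i _ => one_sub_pow_succ_ne_zero hq i
  have hf := fC_ne_zero hq
  have hlim : Tendsto (fun N : ℕ => P (2 * N) * ((P (n + N).toNat)⁻¹ * (P (-n + N).toNat)⁻¹)) atTop
      (𝓝 (fC q * ((fC q)⁻¹ * (fC q)⁻¹))) := by
    have hm : ∀ m : ℤ, Tendsto (fun N : ℕ => (m + N).toNat) atTop atTop := fun m =>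
      tendsto_atTop.mpr fun b => by
        filter_upwards [eventually_ge_atTop (b + m.natAbs)] with N hN
        omega
    have h2 : Tendsto (fun N : ℕ => 2 * N) atTop atTop :=
      tendsto_id.const_mul_atTop' two_pos
    have hPl : Tendsto P atTop (𝓝 (fC q)) := tendsto_fC hq
    exact (hPl.comp h2).mul (((hPl.comp (hm n)).inv₀ hf).mul ((hPl.comp (hm (-n))).inv₀ hf))
  rw [mul_inv_cancel_left₀ hf] at hlim
  refine hlim.congr' ?_
  filter_upwards [eventually_ge_atTop n.natAbs] with N hN
  have := gaussBinom_mul_prod q (2 * N) (n + N).toNat (-n + N).toNat (by omega)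
  have h1 := hP0 (n + N).toNat
  have h2 := hP0 (-n + N).toNat
  simp only [hP] at h1 h2 ⊢
  rw [← this]; field_simp

/-- The general term of the Jacobi theta series `∑ (-1)ⁿ q^(n(n-1)/2) xⁿ`. -/
noncomputable def thetaTerm (q x : ℂ) (n : ℤ) : ℂ := (-1) ^ n * q ^ tri n * x ^ n

lemma summable_norm_thetaTerm {q x : ℂ} (hq0 : q ≠ 0) (hq : ‖q‖ < 1) (hx : x ≠ 0) :
    Summable fun n => ‖thetaTerm q x n‖ := by
  refine (summable_zpow_mul_exp_abs (norm_pos_iff.mpr hq0) hq sq_sub_abs_le_two_mul_tri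
    |Real.log ‖x‖|).of_nonneg_of_le (fun _ => norm_nonneg _) fun n => ?_
  rw [thetaTerm, norm_mul, norm_mul, norm_zpow, norm_neg, norm_one, one_zpow, one_mul, norm_zpow q]
  gcongr
  exact norm_zpow_le_exp hx n

/-- The Jacobi triple product identity. -/
theorem tsum_thetaTerm {q x : ℂ} (hq0 : q ≠ 0) (hq : ‖q‖ < 1) (hx : x ≠ 0) :
    ∑' n, thetaTerm q x n = fC q * (qPoch q x * qPoch q (q * x⁻¹)) := by
  obtain ⟨C, hC⟩ := exists_norm_gaussBinom_le hq
  let F : ℕ → ℤ → ℂ := fun N n =>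
    if n ∈ Finset.Icc (-(N : ℤ)) N then thetaTerm q x n * gaussBinom q (2 * N) (n + N).toNat else 0
  have hF : ∀ N, ∑' n, F N n =
      (∏ i ∈ Finset.range N, (1 - q ^ i * x)) * ∏ i ∈ Finset.range N, (1 - q ^ i * (q * x⁻¹)) := by
    intro N
    rw [tsum_eq_sum (s := Finset.Icc (-(N : ℤ)) N) fun n hn => if_neg hn]
    have h1 := prod_one_sub_eq_sum q x hq0 hx N
    simp only [pow_succ, mul_assoc] at h1 ⊢
    rw [h1]
    refine Finset.sum_bij' (fun n _ => (n + N).toNat) (fun j _ => (j : ℤ) - N) ?_ ?_ ?_ ?_ ?_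
    · intro n hn; simp only [Finset.mem_Icc, Finset.mem_range] at hn ⊢; omega
    · intro n hn; simp only [Finset.mem_Icc, Finset.mem_range] at hn ⊢; omega
    · intro n hn; simp only [Finset.mem_Icc] at hn ⊢; omega
    · intro n hn; simp
    · intro n hn
      simp only [if_pos hn, thetaTerm]
      have : (((n + N).toNat : ℕ) : ℤ) - N = n := by
        simp only [Finset.mem_Icc] at hn; omega
      rw [this]; ring
  have hlim := tendsto_tsum_of_dominated_convergence (𝓕 := atTop) (f := F)
    (g := fun n => thetaTerm q x n * (fC q)⁻¹) (bound := fun n => ‖thetaTerm q x n‖ * C)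
    ((summable_norm_thetaTerm hq0 hq hx).mul_right C)
    (fun n => by
      refine ((tendsto_gaussBinom hq n).const_mul (thetaTerm q x n)).congr' ?_
      filter_upwards [eventually_ge_atTop n.natAbs] with N hN
      have : n ∈ Finset.Icc (-(N : ℤ)) N := by rw [Finset.mem_Icc]; omega
      simp only [F, if_pos this])
    (Eventually.of_forall fun N n => by
      have hC0 : 0 ≤ C := (norm_nonneg _).trans (hC 0 0)
      by_cases hn : n ∈ Finset.Icc (-(N : ℤ)) N
      · simp only [F, if_pos hn, norm_mul]
        gcongr; exact hC _ _
      · simp only [F, if_neg hn, norm_zero]; positivity)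
  simp only [hF] at hlim
  have := tendsto_nhds_unique hlim ((tendsto_qPoch hq x).mul (tendsto_qPoch hq (q * x⁻¹)))
  rw [tsum_mul_right] at this
  rw [← this, mul_comm, inv_mul_cancel_right₀ (fC_ne_zero hq)]

/-- Absolute convergence of `∑ cᵢ e^(aᵢ z)` on the vertical lines with real part in `s`. -/
def ExpSummable {ι : Type*} (s : Set ℝ) (c : ι → ℂ) (a : ι → ℤ) : Prop :=
  ∀ r ∈ s, Summable fun i => ‖c i‖ * exp (a i * r)

/-- The exponential series `∑ cᵢ e^(aᵢ z)`. -/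
noncomputable def expSeries {ι : Type*} (c : ι → ℂ) (a : ι → ℤ) (z : ℂ) : ℂ :=
  ∑' i, c i * Complex.exp (a i * z)

lemma norm_mul_cexp_intCast_mul (c : ℂ) (a : ℤ) (z : ℂ) :
    ‖c * Complex.exp (a * z)‖ = ‖c‖ * exp (a * z.re) := by
  rw [norm_mul, Complex.norm_exp]; simp

lemma ExpSummable.summable_norm {ι : Type*} {s : Set ℝ} {c : ι → ℂ} {a : ι → ℤ}
    (h : ExpSummable s c a) {z : ℂ} (hz : z.re ∈ s) :
    Summable fun i => ‖c i * Complex.exp (a i * z)‖ := by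
  simpa only [norm_mul_cexp_intCast_mul] using h _ hz

lemma exp_mul_le_add {a l r x : ℝ} (h1 : l ≤ x) (h2 : x ≤ r) :
    exp (a * x) ≤ exp (a * l) + exp (a * r) := by
  rcases le_total 0 a with h | h
  · have := Real.exp_le_exp.mpr (mul_le_mul_of_nonneg_left h2 h)
    linarith [Real.exp_pos (a * l)]
  · have := Real.exp_le_exp.mpr (mul_le_mul_of_nonpos_left h1 h)
    linarith [Real.exp_pos (a * r)]

lemma exists_pos_sub_add_mem {s : Set ℝ} (hs : IsOpen s) {r : ℝ} (hr : r ∈ s) :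
    ∃ δ > 0, r - δ ∈ s ∧ r + δ ∈ s := by
  obtain ⟨ε, hε, h⟩ := Metric.isOpen_iff.mp hs r hr
  refine ⟨ε / 2, by positivity, h ?_, h ?_⟩ <;>
  · simp [abs_of_pos hε]; linarith

lemma ExpSummable.mul_exponent {ι : Type*} {s : Set ℝ} (hs : IsOpen s) {c : ι → ℂ} {a : ι → ℤ}
    (h : ExpSummable s c a) : ExpSummable s (fun i => a i * c i) a := by
  intro r hr
  obtain ⟨δ, hδ, h1, h2⟩ := exists_pos_sub_add_mem hs hr
  refine (((h _ h1).add (h _ h2)).mul_left δ⁻¹).of_nonneg_of_le (fun i => by positivity) fun i => ?_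
  have key : |(a i : ℝ)| * exp (a i * r) ≤ δ⁻¹ * (exp (a i * (r - δ)) + exp (a i * (r + δ))) := by
    rw [← div_eq_inv_mul, le_div_iff₀ hδ]
    have e1 : δ * |(a i : ℝ)| ≤ exp (δ * |(a i : ℝ)|) := by
      linarith [Real.add_one_le_exp (δ * |(a i : ℝ)|)]
    have e2 : exp (δ * |(a i : ℝ)|) * exp (a i * r) ≤
        exp (a i * (r - δ)) + exp (a i * (r + δ)) := by
      rw [← Real.exp_add]
      rcases abs_choice (a i : ℝ) with h | h <;> rw [h]
      · rw [show δ * (a i : ℝ) + a i * r = a i * (r + δ) by ring]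
        linarith [Real.exp_pos (a i * (r - δ))]
      · rw [show δ * -(a i : ℝ) + a i * r = a i * (r - δ) by ring]
        linarith [Real.exp_pos (a i * (r + δ))]
    nlinarith [mul_le_mul_of_nonneg_right e1 (Real.exp_pos (a i * r)).le]
  rw [norm_mul, Complex.norm_intCast]
  nlinarith [mul_le_mul_of_nonneg_left key (norm_nonneg (c i))]

lemma ExpSummable.hasDerivAt {ι : Type*} {s : Set ℝ} (hs : IsOpen s) {c : ι → ℂ} {a : ι → ℤ}
    (h : ExpSummable s c a) {z : ℂ} (hz : z.re ∈ s) :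
    HasDerivAt (expSeries c a) (expSeries (fun i => a i * c i) a z) z := by
  obtain ⟨δ, hδ, h1, h2⟩ := exists_pos_sub_add_mem hs hz
  have hsum := (h _ h1).add (h _ h2)
  set U : Set ℂ := Complex.re ⁻¹' Set.Ioo (z.re - δ) (z.re + δ) with hU
  have hUo : IsOpen U := isOpen_Ioo.preimage Complex.continuous_re
  have hzU : z ∈ U := by simp [hU, hδ]
  have hd : ∀ i, DifferentiableOn ℂ (fun z => c i * Complex.exp (a i * z)) U := fun i => by fun_prop
  have hb : ∀ i, ∀ w ∈ U, ‖c i * Complex.exp (a i * w)‖ ≤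
      ‖c i‖ * exp (a i * (z.re - δ)) + ‖c i‖ * exp (a i * (z.re + δ)) := by
    intro i w hw
    rw [norm_mul_cexp_intCast_mul, ← mul_add]
    exact mul_le_mul_of_nonneg_left (exp_mul_le_add hw.1.le hw.2.le) (norm_nonneg _)
  have hdiff := (Complex.differentiableOn_tsum_of_summable_norm hsum hd hUo hb).differentiableAt
    (hUo.mem_nhds hzU)
  have hder := Complex.hasSum_deriv_of_summable_norm hsum hd hUo hb hzU
  have : expSeries (fun i => a i * c i) a z =
      deriv (fun w => ∑' i, c i * Complex.exp (a i * w)) z := by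
    rw [← hder.tsum_eq, expSeries]
    refine tsum_congr fun i => ?_
    have : HasDerivAt (fun w => c i * Complex.exp (a i * w))
        (c i * (Complex.exp (a i * z) * (a i * 1))) z :=
      (((hasDerivAt_id z).const_mul (a i : ℂ)).cexp).const_mul (c i)
    rw [this.deriv]; ring
  rw [this]
  exact hdiff.hasDerivAt

lemma expSummable_of_sq_sub_abs_le {q : ℂ} (hq0 : q ≠ 0) (hq : ‖q‖ < 1) {g a : ℤ → ℤ} {c : ℤ → ℂ}
    (hg : ∀ n, n ^ 2 - |n| ≤ 2 * g n) (ha : ∀ n, |a n| ≤ 2 * |n| + 1)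
    (hc : ∀ n, ‖c n‖ = ‖q ^ g n‖) : ExpSummable Set.univ c a := by
  intro r _
  refine ((summable_zpow_mul_exp_abs (norm_pos_iff.mpr hq0) hq hg (2 * |r|)).mul_right
    (exp |r|)).of_nonneg_of_le (fun n => by positivity) fun n => ?_
  rw [hc, norm_zpow, mul_assoc, ← Real.exp_add]
  gcongr
  have h1 : |(a n : ℝ)| ≤ 2 * |(n : ℝ)| + 1 := by exact_mod_cast ha n
  calc (a n : ℝ) * r ≤ |(a n : ℝ) * r| := le_abs_self _
    _ = |(a n : ℝ)| * |r| := abs_mul _ _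
    _ ≤ (2 * |(n : ℝ)| + 1) * |r| := by gcongr
    _ = _ := by ring

/-- The coefficients of the theta series `∑ (-1)ⁿ q^(n(n-1)/2) e^(nz)`. -/
noncomputable def thetaCoeff (q : ℂ) (n : ℤ) : ℂ := (-1) ^ n * q ^ tri n

/-- The theta series `∑ (-1)ⁿ q^(n(n-1)/2) e^(nz)`. -/
noncomputable def thetaExp (q : ℂ) : ℂ → ℂ := expSeries (thetaCoeff q) id

lemma thetaExp_eq {q : ℂ} (hq0 : q ≠ 0) (hq : ‖q‖ < 1) (z : ℂ) :
    thetaExp q z = fC q * (qPoch q (Complex.exp z) * qPoch q (q * (Complex.exp z)⁻¹)) := by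
  rw [← tsum_thetaTerm hq0 hq (Complex.exp_ne_zero z)]
  refine tsum_congr fun n => ?_
  rw [thetaTerm, thetaCoeff, Complex.exp_int_mul]
  rfl

lemma expSummable_thetaCoeff {q : ℂ} (hq0 : q ≠ 0) (hq : ‖q‖ < 1) :
    ExpSummable Set.univ (thetaCoeff q) id :=
  expSummable_of_sq_sub_abs_le hq0 hq sq_sub_abs_le_two_mul_tri
    (fun n => by have := abs_nonneg n; simp only [id]; omega) (fun n => by simp [thetaCoeff])

/-- The theta series `∑ q^(l²) e^(2lz)`. -/
noncomputable def thetaEven (q : ℂ) : ℂ → ℂ :=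
  expSeries (fun l : ℤ => q ^ (l ^ 2)) (fun l => 2 * l)

/-- The theta series `∑ q^(l²+l) e^((2l+1)z)`. -/
noncomputable def thetaOdd (q : ℂ) : ℂ → ℂ :=
  expSeries (fun l : ℤ => q ^ (l ^ 2 + l)) (fun l => 2 * l + 1)

lemma expSummable_thetaEven {q : ℂ} (hq0 : q ≠ 0) (hq : ‖q‖ < 1) :
    ExpSummable Set.univ (fun l : ℤ => q ^ (l ^ 2)) (fun l => 2 * l) :=
  expSummable_of_sq_sub_abs_le hq0 hq (g := fun l => l ^ 2)
    (fun n => by nlinarith [abs_nonneg n, sq_nonneg n])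
    (fun n => by rw [abs_mul]; norm_num) (fun n => rfl)

lemma expSummable_thetaOdd {q : ℂ} (hq0 : q ≠ 0) (hq : ‖q‖ < 1) :
    ExpSummable Set.univ (fun l : ℤ => q ^ (l ^ 2 + l)) (fun l => 2 * l + 1) :=
  expSummable_of_sq_sub_abs_le hq0 hq (g := fun l => l ^ 2 + l)
    (fun n => by
      have h1 : -|n| ≤ n := neg_abs_le n
      have h2 : |n| ≤ n ^ 2 := by rw [← sq_abs]; exact Int.le_self_sq _
      linarith)
    (fun n => by
      calc |2 * n + 1| ≤ |2 * n| + |1| := abs_add_le _ _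
        _ = _ := by rw [abs_mul]; norm_num) (fun n => rfl)

/-- Splitting of `ℤ × ℤ` by the parity of the sum of the coordinates. -/
noncomputable def parityEquiv : (ℤ × ℤ) ⊕ (ℤ × ℤ) ≃ ℤ × ℤ :=
  Equiv.ofBijective
    (Sum.elim (fun p => (p.1 + 1 + p.2, p.1 + 1 - p.2)) (fun p => (p.1 + p.2 + 1, p.1 - p.2))) <| by
    constructor
    · rintro (⟨k, l⟩ | ⟨k, l⟩) (⟨k', l'⟩ | ⟨k', l'⟩) h <;>
      simp only [Sum.elim_inl, Sum.elim_inr, Prod.mk.injEq, Sum.inl.injEq, Sum.inr.injEq,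
        reduceCtorEq] at h ⊢ <;> omega
    · rintro ⟨m, n⟩
      rcases Int.emod_two_eq_zero_or_one (m + n) with h | h
      · refine ⟨Sum.inl ((m + n) / 2 - 1, (m - n) / 2), ?_⟩
        simp only [Sum.elim_inl, Prod.mk.injEq]; omega
      · refine ⟨Sum.inr ((m + n) / 2, (m - n) / 2), ?_⟩
        simp only [Sum.elim_inr, Prod.mk.injEq]; omega

lemma parityEquiv_inl (k l : ℤ) : parityEquiv (Sum.inl (k, l)) = (k + 1 + l, k + 1 - l) := rfl

lemma parityEquiv_inr (k l : ℤ) : parityEquiv (Sum.inr (k, l)) = (k + l + 1, k - l) := rfl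

lemma thetaExp_add_mul_thetaExp_sub {q : ℂ} (hq0 : q ≠ 0) (hq : ‖q‖ < 1) (z w : ℂ) :
    thetaExp q (z + w) * thetaExp q (z - w) =
      Complex.exp z * (thetaOdd q z * thetaEven q w - thetaEven q z * thetaOdd q w) := by
  have hT := fun z => (expSummable_thetaCoeff hq0 hq).summable_norm (z := z) (Set.mem_univ _)
  have hE := fun z => (expSummable_thetaEven hq0 hq).summable_norm (z := z) (Set.mem_univ _)
  have hO := fun z => (expSummable_thetaOdd hq0 hq).summable_norm (z := z) (Set.mem_univ _)
  have h1 := (summable_mul_of_summable_norm (hO z) (hE w)).hasSum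
  rw [← tsum_mul_tsum_of_summable_norm (hO z) (hE w)] at h1
  have h2 := (summable_mul_of_summable_norm (hE z) (hO w)).hasSum
  rw [← tsum_mul_tsum_of_summable_norm (hE z) (hO w)] at h2
  have h3 : HasSum
      ((fun p : ℤ × ℤ => thetaCoeff q p.1 * Complex.exp (((id p.1 : ℤ) : ℂ) * (z + w)) *
      (thetaCoeff q p.2 * Complex.exp (((id p.2 : ℤ) : ℂ) * (z - w)))) ∘ parityEquiv) 
      (Complex.exp z * (thetaOdd q z * thetaEven q w) +
        -(Complex.exp z * (thetaEven q z * thetaOdd q w))) := by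
    refine HasSum.sum ((h1.mul_left (Complex.exp z)).congr_fun ?_)
      (((h2.mul_left (Complex.exp z)).neg).congr_fun ?_)
    · rintro ⟨k, l⟩
      have e : q ^ tri (k + 1 + l) * q ^ tri (k + 1 - l) = q ^ (k ^ 2 + k) * q ^ (l ^ 2) := by
        rw [← zpow_add₀ hq0, ← zpow_add₀ hq0]; congr 1
        linarith [two_mul_tri (k + 1 + l), two_mul_tri (k + 1 - l)]
      have s : ((-1 : ℂ) ^ (k + 1 + l)) * (-1) ^ (k + 1 - l) = 1 := by
        rw [← zpow_add₀ (by norm_num), show k + 1 + l + (k + 1 - l) = 2 * (k + 1) by ring,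
          zpow_mul]; norm_num
      have x : Complex.exp (((k + 1 + l : ℤ) : ℂ) * (z + w)) *
          Complex.exp (((k + 1 - l : ℤ) : ℂ) * (z - w)) = Complex.exp z *
          (Complex.exp (((2 * k + 1 : ℤ) : ℂ) * z) * Complex.exp (((2 * l : ℤ) : ℂ) * w)) := by
        rw [← Complex.exp_add, ← Complex.exp_add, ← Complex.exp_add]; congr 1; push_cast; ring
      simp only [Function.comp, parityEquiv_inl, thetaCoeff, id]
      linear_combination (((-1 : ℂ) ^ (k + 1 + l)) * (-1) ^ (k + 1 - l) *
        (q ^ tri (k + 1 + l) * q ^ tri (k + 1 - l))) * x + Complex.exp z *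
          (Complex.exp (((2 * k + 1 : ℤ) : ℂ) * z) * Complex.exp (((2 * l : ℤ) : ℂ) * w)) *
          ((q ^ tri (k + 1 + l) * q ^ tri (k + 1 - l)) * s + e)
    · rintro ⟨k, l⟩
      have e : q ^ tri (k + l + 1) * q ^ tri (k - l) = q ^ (k ^ 2) * q ^ (l ^ 2 + l) := by
        rw [← zpow_add₀ hq0, ← zpow_add₀ hq0]; congr 1
        linarith [two_mul_tri (k + l + 1), two_mul_tri (k - l)]
      have s : ((-1 : ℂ) ^ (k + l + 1)) * (-1) ^ (k - l) = -1 := by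
        rw [← zpow_add₀ (by norm_num), show k + l + 1 + (k - l) = 2 * k + 1 by ring,
          zpow_add₀ (by norm_num), zpow_mul]; norm_num
      have x : Complex.exp (((k + l + 1 : ℤ) : ℂ) * (z + w)) *
          Complex.exp (((k - l : ℤ) : ℂ) * (z - w)) = Complex.exp z *
          (Complex.exp (((2 * k : ℤ) : ℂ) * z) * Complex.exp (((2 * l + 1 : ℤ) : ℂ) * w)) := by
        rw [← Complex.exp_add, ← Complex.exp_add, ← Complex.exp_add]; congr 1; push_cast; ring
      simp only [Function.comp, parityEquiv_inr, thetaCoeff, id]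
      linear_combination (((-1 : ℂ) ^ (k + l + 1)) * (-1) ^ (k - l) *
        (q ^ tri (k + l + 1) * q ^ tri (k - l))) * x + Complex.exp z *
          (Complex.exp (((2 * k : ℤ) : ℂ) * z) * Complex.exp (((2 * l + 1 : ℤ) : ℂ) * w)) *
          ((q ^ tri (k + l + 1) * q ^ tri (k - l)) * s - e)
  rw [parityEquiv.hasSum_iff] at h3
  rw [thetaExp, expSeries, expSeries, tsum_mul_tsum_of_summable_norm (hT _) (hT _), h3.tsum_eq]
  ring

lemma eq_of_hasDerivAt {f g : ℂ → ℂ} (hfg : ∀ z, f z = g z) {f' g' z : ℂ}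
    (hf : HasDerivAt f f' z) (hg : HasDerivAt g g' z) : f' = g' := by
  obtain rfl : f = g := funext hfg
  exact hf.unique hg

/-- An addition formula of theta type forces a third order differential equation. -/
lemma third_order_of_addition_formula {T T1 T2 T3 u u1 u2 v v1 v2 : ℂ → ℂ}
    (hT : ∀ z, HasDerivAt T (T1 z) z) (hT1 : ∀ z, HasDerivAt T1 (T2 z) z)
    (hT2 : ∀ z, HasDerivAt T2 (T3 z) z)
    (hu : ∀ z, HasDerivAt u (u1 z) z) (hu1 : ∀ z, HasDerivAt u1 (u2 z) z)
    (hv : ∀ z, HasDerivAt v (v1 z) z) (hv1 : ∀ z, HasDerivAt v1 (v2 z) z)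
    (h : ∀ z w, T (z + w) * T (z - w) = Complex.exp z * (v z * u w - u z * v w)) (z : ℂ) :
    T3 z * T z ^ 3 - 3 * T2 z * T1 z * T z ^ 2 + 2 * T1 z ^ 3 * T z =
      T1 0 ^ 3 * Complex.exp z * T (2 * z) := by
  have hadd : ∀ {f f' : ℂ → ℂ}, (∀ z, HasDerivAt f (f' z) z) → ∀ z w,
      HasDerivAt (fun w => f (z + w)) (f' (z + w)) w := fun hf z w => by
    simpa using (hf (z + w)).comp_const_add z w
  have hsub : ∀ {f f' : ℂ → ℂ}, (∀ z, HasDerivAt f (f' z) z) → ∀ z w,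
      HasDerivAt (fun w => f (z - w)) (-f' (z - w)) w := fun hf z w => by
    simpa using (hf (z - w)).comp_const_sub z w
  have hT0 : T 0 = 0 := by
    have := h 0 0
    simp only [add_zero, sub_zero, Complex.exp_zero] at this
    exact mul_self_eq_zero.mp (by rw [this]; ring)
  have hw : ∀ z w, T1 (z + w) * T (z - w) - T (z + w) * T1 (z - w) =
      Complex.exp z * (v z * u1 w - u z * v1 w) := fun z w => by
    have := eq_of_hasDerivAt (h z) ((hadd hT z w).mul (hsub hT z w))
      ((((hu w).const_mul (v z)).sub ((hv w).const_mul (u z))).const_mul (Complex.exp z))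
    linear_combination this
  have hww : ∀ z w, T2 (z + w) * T (z - w) - 2 * T1 (z + w) * T1 (z - w) +
      T (z + w) * T2 (z - w) = Complex.exp z * (v z * u2 w - u z * v2 w) := fun z w => by
    have := eq_of_hasDerivAt (hw z) (((hadd hT1 z w).mul (hsub hT z w)).sub
        ((hadd hT z w).mul (hsub hT1 z w)))
      ((((hu1 w).const_mul (v z)).sub ((hv1 w).const_mul (u z))).const_mul (Complex.exp z))
    linear_combination this
  have p0 : ∀ z, T z * T z = Complex.exp z * (v z * u 0 - u z * v 0) := fun z => by
    simpa using h z 0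
  have p1 := eq_of_hasDerivAt p0 ((hT z).mul (hT z))
    ((Complex.hasDerivAt_exp z).mul (((hv z).mul_const (u 0)).sub ((hu z).mul_const (v 0))))
  have r0 : ∀ z, T2 z * T z - 2 * T1 z * T1 z + T z * T2 z =
      Complex.exp z * (v z * u2 0 - u z * v2 0) := fun z => by
    simpa using hww z 0
  have r1 := eq_of_hasDerivAt (fun z => (by linear_combination r0 z :
      2 * (T2 z * T z) - 2 * (T1 z * T1 z) = Complex.exp z * (v z * u2 0 - u z * v2 0)))
    ((((hT2 z).mul (hT z)).const_mul 2).sub (((hT1 z).mul (hT1 z)).const_mul 2))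
    ((Complex.hasDerivAt_exp z).mul (((hv z).mul_const (u2 0)).sub ((hu z).mul_const (v2 0))))
  have r00 := r0 0
  have qz := hw z z
  rw [sub_self, ← two_mul, hT0] at qz
  rw [hT0, Complex.exp_zero] at r00
  have pz := p0 z
  have rz := r0 z
  have key : (T z * T z) * (2 * (T3 z * T z - T2 z * T1 z)) -
      (2 * T z * T1 z) * (T2 z * T z - 2 * T1 z * T1 z + T z * T2 z) =
      Complex.exp z * (T (2 * z) * T1 0 * (2 * T1 0 * T1 0)) := by
    set e := Complex.exp z
    calc _ = (e * (v z * u 0 - u z * v 0)) * (e * (v z * u2 0 - u z * v2 0) +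
            e * (v1 z * u2 0 - u1 z * v2 0)) -
          (e * (v z * u 0 - u z * v 0) + e * (v1 z * u 0 - u1 z * v 0)) *
            (e * (v z * u2 0 - u z * v2 0)) := by
          rw [← r1, ← p1, ← rz, ← pz]; ring
      _ = e * (e * (v z * u1 z - u z * v1 z)) * (1 * (v 0 * u2 0 - u 0 * v2 0)) := by ring
      _ = _ := by rw [← r00, ← qz]; ring
  linear_combination key / 2

/-- The third order differential equation satisfied by the theta series. -/
lemma thetaExp_third_order {q : ℂ} (hq0 : q ≠ 0) (hq : ‖q‖ < 1) :
    ∃ T1 T2 T3 : ℂ → ℂ, (∀ z, HasDerivAt (thetaExp q) (T1 z) z) ∧ (∀ z, HasDerivAt T1 (T2 z) z) ∧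
      (∀ z, HasDerivAt T2 (T3 z) z) ∧ ∀ z,
      T3 z * thetaExp q z ^ 3 - 3 * T2 z * T1 z * thetaExp q z ^ 2 + 2 * T1 z ^ 3 * thetaExp q z =
        T1 0 ^ 3 * Complex.exp z * thetaExp q (2 * z) := by
  have hT := expSummable_thetaCoeff hq0 hq
  have hE := expSummable_thetaEven hq0 hq
  have hO := expSummable_thetaOdd hq0 hq
  have d : ∀ {c : ℤ → ℂ} {a : ℤ → ℤ}, ExpSummable Set.univ c a → ∀ z,
      HasDerivAt (expSeries c a) (expSeries (fun i => a i * c i) a z) z :=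
    fun h z => h.hasDerivAt isOpen_univ (Set.mem_univ _)
  have m : ∀ {c : ℤ → ℂ} {a : ℤ → ℤ}, ExpSummable Set.univ c a →
      ExpSummable Set.univ (fun i => a i * c i) a := fun h => h.mul_exponent isOpen_univ
  exact ⟨_, _, _, d hT, d (m hT), d (m (m hT)), third_order_of_addition_formula (d hT) (d (m hT))
    (d (m (m hT))) (d hE) (d (m hE)) (d hO) (d (m hO)) (thetaExp_add_mul_thetaExp_sub hq0 hq)⟩

/-- The coefficients of the power series of `-log (a; q)_∞`. -/
noncomputable def logCoeff (q : ℂ) (k : ℕ) : ℂ := ((k + 1) * (1 - q ^ (k + 1)))⁻¹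

/-- The function `-log (eᶻ; q)_∞`. -/
noncomputable def logPoch (q : ℂ) : ℂ → ℂ := expSeries (logCoeff q) (fun k => ((k + 1 : ℕ) : ℤ))

lemma one_sub_norm_le_norm_one_sub_pow {q : ℂ} (hq : ‖q‖ < 1) (k : ℕ) :
    1 - ‖q‖ ≤ ‖1 - q ^ (k + 1)‖ := by
  have h1 := norm_sub_norm_le (1 : ℂ) (q ^ (k + 1))
  rw [norm_one, norm_pow] at h1
  have h2 := pow_le_of_le_one (norm_nonneg q) hq.le (Nat.add_one_ne_zero k)
  linarith

lemma expSummable_logCoeff {q : ℂ} (hq : ‖q‖ < 1) :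
    ExpSummable (Set.Iio 0) (logCoeff q) (fun k => ((k + 1 : ℕ) : ℤ)) := by
  intro r hr
  have hr' : exp r < 1 := (Real.exp_lt_one_iff.mpr hr)
  refine (((summable_geometric_of_lt_one (Real.exp_pos r).le hr').mul_right (exp r)).mul_left
    (1 - ‖q‖)⁻¹).of_nonneg_of_le (fun k => by positivity) fun k => ?_
  have h1 := one_sub_norm_le_norm_one_sub_pow hq k
  have e : exp ((((k + 1 : ℕ) : ℤ) : ℝ) * r) = exp r ^ k * exp r := by
    rw [Int.cast_natCast, Real.exp_nat_mul, pow_succ]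
  rw [e]
  gcongr
  rw [logCoeff, norm_inv, norm_mul]
  refine inv_anti₀ (by linarith) (h1.trans ?_)
  refine le_mul_of_one_le_left (norm_nonneg _) ?_
  have : ((k : ℂ) + 1) = ((k + 1 : ℕ) : ℂ) := by push_cast; ring
  rw [this, Complex.norm_natCast]
  exact_mod_cast Nat.succ_le_succ (Nat.zero_le k)

lemma hasSum_neg_log_one_sub {a : ℂ} (ha : ‖a‖ < 1) :
    HasSum (fun k : ℕ => a ^ (k + 1) / (k + 1)) (-Complex.log (1 - a)) := by
  have := (hasSum_nat_add_iff' 1).mpr (Complex.hasSum_taylorSeries_neg_log ha)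
  simpa using this

lemma qPoch_exp {q : ℂ} (hq : ‖q‖ < 1) {z : ℂ} (hz : z.re < 0) :
    qPoch q (Complex.exp z) = Complex.exp (-logPoch q z) := by
  set a := Complex.exp z with ha
  have ha1 : ‖a‖ < 1 := by rw [ha, Complex.norm_exp]; exact (Real.exp_lt_one_iff.mpr hz)
  have hqa : ∀ n : ℕ, ‖q ^ n * a‖ < 1 := fun n => by
    rw [norm_mul, norm_pow]
    exact mul_lt_one_of_nonneg_of_lt_one_right (pow_le_one₀ (norm_nonneg _) hq.le)
      (norm_nonneg _) ha1
  have hne : ∀ n : ℕ, 1 - q ^ n * a ≠ 0 := fun n h => by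
    have := hqa n
    rw [← sub_eq_zero.mp h, norm_one] at this
    exact lt_irrefl _ this
  have hlog : Summable fun n : ℕ => Complex.log (1 - q ^ n * a) := by
    have := Complex.summable_log_one_add_of_summable (f := fun n : ℕ => -(q ^ n * a))
      (summable_neg_pow hq a).of_norm
    simpa only [← sub_eq_add_neg] using this
  have hdouble : Summable
      (Function.uncurry fun n k : ℕ => (q ^ n * a) ^ (k + 1) / ((k : ℂ) + 1)) := by
    refine Summable.of_norm_bounded (g := fun p : ℕ × ℕ => ‖q‖ ^ p.1 * ‖a‖ ^ p.2)
      ((summable_geometric_of_lt_one (norm_nonneg q) hq).mul_of_nonneg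
        (summable_geometric_of_lt_one (norm_nonneg a) ha1)
        (fun n => by positivity) (fun n => by positivity)) ?_
    rintro ⟨n, k⟩
    simp only [Function.uncurry]
    rw [show ((k : ℂ) + 1) = ((k + 1 : ℕ) : ℂ) by push_cast; ring, norm_div, Complex.norm_natCast]
    refine (div_le_self (norm_nonneg _)
      (by exact_mod_cast Nat.succ_le_succ (Nat.zero_le k))).trans ?_
    rw [norm_pow, norm_mul, norm_pow, mul_pow]
    gcongr ?_ * ?_
    · exact pow_le_of_le_one (by positivity) (pow_le_one₀ (norm_nonneg _) hq.le) k.succ_ne_zero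
    · exact pow_le_pow_of_le_one (norm_nonneg _) ha1.le k.le_succ
  have hswap : ∑' n : ℕ, Complex.log (1 - q ^ n * a) = -logPoch q z := by
    rw [← neg_inj, neg_neg, ← tsum_neg]
    simp_rw [← (hasSum_neg_log_one_sub (hqa _)).tsum_eq]
    rw [← hdouble.tsum_comm, logPoch, expSeries]
    refine tsum_congr fun k => ?_
    have hqk : ‖q ^ (k + 1)‖ < 1 := by
      rw [norm_pow]; exact pow_lt_one₀ (norm_nonneg _) hq k.succ_ne_zero
    have hg := (hasSum_geometric_of_norm_lt_one hqk).mul_right (a ^ (k + 1) / ((k : ℂ) + 1))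
    rw [Int.cast_natCast, Complex.exp_nat_mul, ← ha, logCoeff]
    refine (hg.congr_fun fun n => ?_).tsum_eq.trans ?_
    · rw [mul_pow, ← pow_mul, ← pow_mul, mul_comm n]; ring
    · rw [mul_inv]; ring
  rw [qPoch, ← Complex.cexp_tsum_eq_tprod hne hlog, hswap]

lemma qPoch_eq_one_sub_mul {q : ℂ} (hq : ‖q‖ < 1) (a : ℂ) :
    qPoch q a = (1 - a) * qPoch q (q * a) := by
  have h1 := (tendsto_qPoch hq a).comp (tendsto_add_atTop_nat 1)
  refine tendsto_nhds_unique h1 (((tendsto_qPoch hq (q * a)).const_mul (1 - a)).congr fun N => ?_)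
  rw [Function.comp, Finset.prod_range_succ', mul_comm]
  simp [pow_succ, mul_assoc]

lemma hasDerivAt_thetaExp_zero {τ : ℂ} (hτ : τ.re < 0) :
    HasDerivAt (thetaExp (Complex.exp τ)) (-fC (Complex.exp τ) ^ 3) 0 := by
  set q := Complex.exp τ with hqdef
  have hq0 : q ≠ 0 := Complex.exp_ne_zero τ
  have hq : ‖q‖ < 1 := by rw [hqdef, Complex.norm_exp]; exact (Real.exp_lt_one_iff.mpr hτ)
  set g : ℂ → ℂ := fun z => fC q * (Complex.exp (-logPoch q (τ + z)) *
    Complex.exp (-logPoch q (τ - z))) with hg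
  have hL : ∀ z : ℂ, z.re < 0 → DifferentiableAt ℂ (logPoch q) z := fun z hz =>
    ((expSummable_logCoeff hq).hasDerivAt isOpen_Iio hz).differentiableAt
  have hgd : DifferentiableAt ℂ g 0 := by
    have h1 : DifferentiableAt ℂ (fun z => logPoch q (τ + z)) 0 :=
      DifferentiableAt.comp (0 : ℂ) (hL (τ + 0) (by simpa using hτ)) (by fun_prop)
    have h2 : DifferentiableAt ℂ (fun z => logPoch q (τ - z)) 0 :=
      DifferentiableAt.comp (0 : ℂ) (hL (τ - 0) (by simpa using hτ)) (by fun_prop)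
    fun_prop
  have hg0 : g 0 = fC q ^ 3 := by
    simp only [hg, add_zero, sub_zero]
    rw [← qPoch_exp hq hτ, ← hqdef, ← fC_eq_qPoch]; ring
  have hev : thetaExp q =ᶠ[𝓝 0] fun z => (1 - Complex.exp z) * g z := by
    have hU : {z : ℂ | (τ + z).re < 0 ∧ (τ - z).re < 0} ∈ 𝓝 (0 : ℂ) := by
      refine IsOpen.mem_nhds
        ((isOpen_Iio.preimage (f := fun z : ℂ => (τ + z).re) (by fun_prop)).inter
        (isOpen_Iio.preimage (f := fun z : ℂ => (τ - z).re) (by fun_prop))) ?_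
      simpa using hτ
    filter_upwards [hU] with z hz
    rw [thetaExp_eq hq0 hq, qPoch_eq_one_sub_mul hq, ← Complex.exp_neg, hqdef, ← Complex.exp_add,
      ← Complex.exp_add, ← hqdef, ← sub_eq_add_neg, qPoch_exp hq hz.1, qPoch_exp hq hz.2]
    simp only [hg]; ring
  have h1 : HasDerivAt (fun z : ℂ => 1 - Complex.exp z) (-Complex.exp 0) 0 :=
    (Complex.hasDerivAt_exp 0).const_sub 1
  refine ((h1.mul hgd.hasDerivAt).congr_of_eventuallyEq hev).congr_deriv ?_
  rw [hg0]; simp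

/-- The third derivative of the logarithm of the theta series. -/
lemma lambert_mul_thetaExp_pow {τ z : ℂ} (hτ : τ.re < z.re) (hz : z.re < 0) :
    (expSeries (fun k : ℕ => ((k : ℂ) + 1) ^ 2 / (1 - Complex.exp τ ^ (k + 1)))
        (fun k => ((k + 1 : ℕ) : ℤ)) z -
      expSeries (fun k : ℕ => ((k : ℂ) + 1) ^ 2 / (1 - Complex.exp τ ^ (k + 1)))
        (fun k => ((k + 1 : ℕ) : ℤ)) (τ - z)) * thetaExp (Complex.exp τ) z ^ 4 =
      fC (Complex.exp τ) ^ 9 * Complex.exp z * thetaExp (Complex.exp τ) (2 * z) := by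
  have hτ0 : τ.re < 0 := hτ.trans hz
  set q := Complex.exp τ with hqdef
  have hq0 : q ≠ 0 := Complex.exp_ne_zero τ
  have hq : ‖q‖ < 1 := by rw [hqdef, Complex.norm_exp]; exact Real.exp_lt_one_iff.mpr hτ0
  obtain ⟨T1, T2, T3, hT, hT1, hT2, hN⟩ := thetaExp_third_order hq0 hq
  have hT10 : T1 0 = -fC q ^ 3 := (hT 0).unique (hasDerivAt_thetaExp_zero hτ0)
  have hS := expSummable_logCoeff hq
  have hS1 := hS.mul_exponent isOpen_Iio
  have hS2 := hS1.mul_exponent isOpen_Iio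
  have d0 := fun {z : ℂ} (hz : z.re < 0) => hS.hasDerivAt isOpen_Iio hz
  have d1 := fun {z : ℂ} (hz : z.re < 0) => hS1.hasDerivAt isOpen_Iio hz
  have d2 := fun {z : ℂ} (hz : z.re < 0) => hS2.hasDerivAt isOpen_Iio hz
  have hc : (fun k : ℕ => ((((k + 1 : ℕ) : ℤ)) : ℂ) * (((((k + 1 : ℕ) : ℤ)) : ℂ) *
      (((((k + 1 : ℕ) : ℤ)) : ℂ) * logCoeff q k))) =
      fun k : ℕ => ((k : ℂ) + 1) ^ 2 / (1 - q ^ (k + 1)) := by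
    funext k
    have h1 : (k : ℂ) + 1 ≠ 0 := by exact_mod_cast Nat.succ_ne_zero k
    have h2 := one_sub_pow_succ_ne_zero hq k
    rw [logCoeff]; push_cast; field_simp
  rw [hc] at d2
  change ∀ {z : ℂ}, z.re < 0 → HasDerivAt (logPoch q) _ z at d0
  set L := logPoch q
  set L1 := expSeries (fun k : ℕ => ((((k + 1 : ℕ) : ℤ)) : ℂ) * logCoeff q k)
    (fun k => ((k + 1 : ℕ) : ℤ))
  set L2 := expSeries (fun k : ℕ => ((((k + 1 : ℕ) : ℤ)) : ℂ) * (((((k + 1 : ℕ) : ℤ)) : ℂ) *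
    logCoeff q k)) (fun k => ((k + 1 : ℕ) : ℤ))
  set L3 := expSeries (fun k : ℕ => ((k : ℂ) + 1) ^ 2 / (1 - q ^ (k + 1)))
    (fun k => ((k + 1 : ℕ) : ℤ))
  set U : Set ℂ := {z | τ.re < z.re ∧ z.re < 0} with hU
  have hUo : IsOpen U := (isOpen_Ioi.preimage Complex.continuous_re).inter
    (isOpen_Iio.preimage Complex.continuous_re)
  have hzU : z ∈ U := ⟨hτ, hz⟩
  have hsub : ∀ {f f' : ℂ → ℂ}, (∀ {z : ℂ}, z.re < 0 → HasDerivAt f (f' z) z) → ∀ z ∈ U,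
      HasDerivAt (fun w => f (τ - w)) (-f' (τ - z)) z := fun hf z hz => by
    simpa using (hf (z := τ - z) (by simpa using hz.1)).comp_const_sub τ z
  have uniq : ∀ {f f' g g' : ℂ → ℂ}, (∀ z ∈ U, f z = g z) → (∀ z, HasDerivAt f (f' z) z) →
      (∀ z ∈ U, HasDerivAt g (g' z) z) → ∀ z ∈ U, f' z = g' z := fun hfg hf hg z hz =>
    (hf z).unique ((hg z hz).congr_of_eventuallyEq
      (Filter.eventuallyEq_of_mem (hUo.mem_nhds hz) hfg))
  have e0 : ∀ z ∈ U, thetaExp q z = fC q * Complex.exp (-(L z + L (τ - z))) := fun z hz => by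
    rw [thetaExp_eq hq0 hq, qPoch_exp hq hz.2, ← Complex.exp_neg, hqdef, ← Complex.exp_add,
      ← sub_eq_add_neg, ← hqdef, qPoch_exp hq (z := τ - z) (by simpa using hz.1),
      ← Complex.exp_add]
    congr 2; ring
  have e1 : ∀ z ∈ U, T1 z = -(L1 z - L1 (τ - z)) * thetaExp q z := by
    intro z hz
    have := uniq e0 hT
        (fun z hz => ((((d0 hz.2).add (hsub d0 z hz)).neg).cexp).const_mul (fC q)) z hz
    simp only [Pi.neg_apply, Pi.add_apply] at this
    rw [this, e0 z hz]
    ring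
  have e2 : ∀ z ∈ U, T2 z = -(L2 z + L2 (τ - z)) * thetaExp q z - (L1 z - L1 (τ - z)) * T1 z := by
    intro z hz
    have := uniq e1 hT1 (fun z hz => (((d1 hz.2).sub (hsub d1 z hz)).neg).mul (hT z)) z hz
    simp only [Pi.neg_apply, Pi.sub_apply] at this
    rw [this]
    ring
  have e3 : ∀ z ∈ U, T3 z = -(L3 z - L3 (τ - z)) * thetaExp q z -
      2 * (L2 z + L2 (τ - z)) * T1 z - (L1 z - L1 (τ - z)) * T2 z := by
    intro z hz
    have := uniq e2 hT2 (fun z hz => ((((d2 hz.2).add (hsub d2 z hz)).neg).mul (hT z)).sub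
      (((d1 hz.2).sub (hsub d1 z hz)).mul (hT1 z))) z hz
    simp only [Pi.neg_apply, Pi.sub_apply, Pi.add_apply] at this
    rw [this]
    ring
  have h := hN z
  rw [hT10, e3 z hzU, e2 z hzU, e1 z hzU] at h
  linear_combination -h

lemma prod_range_three_mul {M : Type*} [CommMonoid M] (f : ℕ → M) (N : ℕ) :
    ∏ i ∈ Finset.range (3 * N), f i =
      (∏ i ∈ Finset.range N, f (3 * i)) * (∏ i ∈ Finset.range N, f (3 * i + 1)) *
        ∏ i ∈ Finset.range N, f (3 * i + 2) := by
  induction N with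
  | zero => simp
  | succ N ih =>
    rw [show 3 * (N + 1) = 3 * N + 1 + 1 + 1 by ring]
    simp only [Finset.prod_range_succ, ih]
    ac_rfl

lemma fC_eq_mul_qPoch_cube {u : ℂ} (hu : ‖u‖ < 1) :
    fC u = fC (u ^ 3) * (qPoch (u ^ 3) u * qPoch (u ^ 3) (u ^ 2)) := by
  have hu3 : ‖u ^ 3‖ < 1 := by
    rw [norm_pow]; exact pow_lt_one₀ (norm_nonneg _) hu three_ne_zero
  have h1 := (tendsto_fC hu).comp
    ((tendsto_id (α := ℕ) (x := atTop)).const_mul_atTop' (by norm_num : 0 < 3))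
  refine tendsto_nhds_unique h1 (((tendsto_fC hu3).mul ((tendsto_qPoch hu3 u).mul
    (tendsto_qPoch hu3 (u ^ 2)))).congr fun N => ?_)
  simp only [Function.comp, id, prod_range_three_mul]
  have : ∀ i : ℕ, u ^ (3 * i + 2 + 1) = (u ^ 3) ^ (i + 1) ∧ u ^ (3 * i + 1 + 1) = (u ^ 3) ^ i *
      u ^ 2 ∧
      u ^ (3 * i + 1) = (u ^ 3) ^ i * u := fun i => by
    refine ⟨?_, ?_, ?_⟩ <;> ring
  simp only [(this _).1, (this _).2.1, (this _).2.2]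
  ring

lemma mul_fC_cube_pow_nine_div {u : ℂ} (hu0 : u ≠ 0) (hu : ‖u‖ < 1) :
    u * (fC (u ^ 3) ^ 9 / fC u ^ 3) =
      ∑' k : ℕ, ((k : ℂ) + 1) ^ 2 *
        ((u ^ (k + 1) - (u ^ (k + 1)) ^ 2) / (1 - (u ^ (k + 1)) ^ 3)) := by
  set z := Complex.log u with hz
  have hez : Complex.exp z = u := Complex.exp_log hu0
  have hzre : z.re < 0 := by
    rw [hz, Complex.log_re]; exact Real.log_neg (norm_pos_iff.mpr hu0) hu
  have hτ : (3 * z).re < z.re := by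
    have : (3 * z).re = 3 * z.re := by simp
    linarith
  have hτ0 : (3 * z - z).re < 0 := by
    rw [Complex.sub_re]; linarith
  have he3 : Complex.exp (3 * z) = u ^ 3 := by
    rw [← hez, ← Complex.exp_nat_mul]; norm_num
  have he2 : Complex.exp (2 * z) = u ^ 2 := by
    rw [← hez, ← Complex.exp_nat_mul]; norm_num
  have hu3 : ‖u ^ 3‖ < 1 := by
    rw [norm_pow]; exact pow_lt_one₀ (norm_nonneg _) hu three_ne_zero
  have hmain := lambert_mul_thetaExp_pow hτ hzre
  have hT1 : thetaExp (u ^ 3) z = fC u := by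
    rw [thetaExp_eq (pow_ne_zero 3 hu0) hu3, hez, fC_eq_mul_qPoch_cube hu]
    congr 3; field_simp
  have hT2 : thetaExp (u ^ 3) (2 * z) = fC u := by
    rw [thetaExp_eq (pow_ne_zero 3 hu0) hu3, he2, fC_eq_mul_qPoch_cube hu, mul_comm (qPoch _ u)]
    congr 3; field_simp
  have hS : ExpSummable (Set.Iio 0) (fun k : ℕ => ((k : ℂ) + 1) ^ 2 / (1 - (u ^ 3) ^ (k + 1)))
      (fun k => ((k + 1 : ℕ) : ℤ)) := by
    convert ((((expSummable_logCoeff hu3).mul_exponent isOpen_Iio).mul_exponent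
      isOpen_Iio).mul_exponent isOpen_Iio) using 2 with k
    have h1 : (k : ℂ) + 1 ≠ 0 := by exact_mod_cast Nat.succ_ne_zero k
    have h2 := one_sub_pow_succ_ne_zero hu3 k
    rw [logCoeff]; push_cast; field_simp
  rw [he3, hT1, hT2, hez, expSeries, expSeries,
    ← (hS.summable_norm hzre).of_norm.tsum_sub (hS.summable_norm hτ0).of_norm] at hmain
  have hf := fC_ne_zero hu
  have : u * (fC (u ^ 3) ^ 9 / fC u ^ 3) = fC (u ^ 3) ^ 9 * u * fC u / fC u ^ 4 := by
    field_simp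
  rw [this, ← hmain, mul_div_cancel_right₀ _ (pow_ne_zero 4 hf)]
  refine tsum_congr fun k => ?_
  rw [show 3 * z - z = 2 * z by ring, Int.cast_natCast, Complex.exp_nat_mul, Complex.exp_nat_mul,
    hez, he2, ← pow_mul, ← pow_mul, ← pow_mul, ← pow_mul, mul_comm 3, mul_comm 2]
  ring

/-- The nonprincipal character modulo `3`. -/
def chiThree (m : ℕ) : ℤ := if m % 3 = 1 then 1 else if m % 3 = 2 then -1 else 0

/-- The nonprincipal character modulo `4`. -/
def chiFour (m : ℕ) : ℤ := if m % 4 = 1 then 1 else if m % 4 = 3 then -1 else 0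

lemma norm_chiThree_le (m : ℕ) : ‖(chiThree m : ℂ)‖ ≤ 1 := by
  unfold chiThree; split_ifs <;> simp

lemma chiThree_zero : chiThree 0 = 0 := rfl

lemma chiThree_add_three (m : ℕ) : chiThree (m + 3) = chiThree m := by simp [chiThree]

lemma hasSum_chiThree_mul_pow {w : ℂ} (hw : ‖w‖ < 1) :
    HasSum (fun m : ℕ => (chiThree m : ℂ) * w ^ m) ((w - w ^ 2) / (1 - w ^ 3)) := by
  have hs : Summable fun m : ℕ => (chiThree m : ℂ) * w ^ m := by
    refine Summable.of_norm_bounded (summable_geometric_of_lt_one (norm_nonneg w) hw) fun m => ?_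
    rw [norm_mul, norm_pow]
    exact mul_le_of_le_one_left (by positivity) (norm_chiThree_le m)
  have h := hs.sum_add_tsum_nat_add 3
  have h012 : chiThree 0 = 0 ∧ chiThree 1 = 1 ∧ chiThree 2 = -1 := ⟨rfl, rfl, rfl⟩
  simp only [chiThree_add_three, pow_add, ← mul_assoc, tsum_mul_right] at h
  have hne : 1 - w ^ 3 ≠ 0 := one_sub_pow_succ_ne_zero hw 2
  convert hs.hasSum using 1
  rw [div_eq_iff hne]
  simp [Finset.sum_range_succ, h012] at h
  linear_combination h

lemma summable_sq_mul_pow {ρ : ℝ} (h0 : 0 ≤ ρ) (h1 : ρ < 1) :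
    Summable fun p : ℕ × ℕ => ((p.1 : ℝ) + 1) ^ 2 * ρ ^ p.1 * ρ ^ p.2 := by
  refine Summable.mul_of_nonneg (f := fun k : ℕ => ((k : ℝ) + 1) ^ 2 * ρ ^ k) ?_
    (summable_geometric_of_lt_one h0 h1) (fun n => by positivity) (fun n => by positivity)
  have h := fun k => summable_pow_mul_geometric_of_norm_lt_one (R := ℝ) (r := ρ) k
    (by rwa [Real.norm_of_nonneg h0])
  refine ((h 2).add (((h 1).mul_left 2).add (h 0))).congr fun n => ?_
  ring

lemma pow_mul_add_one_le {ρ : ℝ} (h0 : 0 ≤ ρ) (h1 : ρ ≤ 1) {k m : ℕ} (hm : m ≠ 0) :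
    ρ ^ (m * (k + 1)) ≤ ρ ^ k * ρ ^ m := by
  rw [← pow_add]
  refine pow_le_pow_of_le_one h0 h1 ?_
  nlinarith [Nat.pos_of_ne_zero hm]

lemma norm_sq_mul_chiThree_mul_pow_le {c : ℂ} (hc : ‖c‖ < 1) (k m : ℕ) :
    ‖((k : ℂ) + 1) ^ 2 * chiThree m * c ^ (m * (k + 1))‖ ≤
      ((k : ℝ) + 1) ^ 2 * ‖c‖ ^ k * ‖c‖ ^ m := by
  rcases eq_or_ne m 0 with rfl | hm
  · simp only [chiThree_zero, Int.cast_zero, mul_zero, zero_mul, norm_zero]; positivity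
  · have hk : ‖(k : ℂ) + 1‖ = (k : ℝ) + 1 := by
      rw [show (k : ℂ) + 1 = ((k + 1 : ℕ) : ℂ) by push_cast; ring, Complex.norm_natCast]
      push_cast; ring
    rw [norm_mul, norm_mul, norm_pow, norm_pow, hk, mul_assoc (((k : ℝ) + 1) ^ 2), mul_assoc]
    refine mul_le_mul_of_nonneg_left ?_ (by positivity)
    calc _ ≤ 1 * ‖c‖ ^ (m * (k + 1)) := by gcongr; exact norm_chiThree_le m
      _ ≤ _ := by rw [one_mul]; exact pow_mul_add_one_le (norm_nonneg _) hc.le hm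

lemma hasSum_mul_fC_cube_pow_nine_div {u : ℂ} (hu0 : u ≠ 0) (hu : ‖u‖ < 1) :
    HasSum (fun p : ℕ × ℕ => ((p.1 : ℂ) + 1) ^ 2 * chiThree p.2 * u ^ (p.2 * (p.1 + 1)))
      (u * (fC (u ^ 3) ^ 9 / fC u ^ 3)) := by
  have hs : Summable fun p : ℕ × ℕ =>
      ((p.1 : ℂ) + 1) ^ 2 * chiThree p.2 * u ^ (p.2 * (p.1 + 1)) :=
    Summable.of_norm_bounded (summable_sq_mul_pow (norm_nonneg u) hu)
      fun p => norm_sq_mul_chiThree_mul_pow_le hu p.1 p.2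
  convert hs.hasSum using 1
  rw [mul_fC_cube_pow_nine_div hu0 hu, hs.tsum_prod]
  refine tsum_congr fun k => ?_
  have hw : ‖u ^ (k + 1)‖ < 1 := by
    rw [norm_pow]; exact pow_lt_one₀ (norm_nonneg _) hu (Nat.add_one_ne_zero k)
  refine (((hasSum_chiThree_mul_pow hw).mul_left (((k : ℂ) + 1) ^ 2)).congr_fun fun m =>
    ?_).tsum_eq.symm
  simp only
  rw [← pow_mul, mul_comm m]; ring

/-- Termwise integration of the Lambert series along a segment starting at the origin. -/
lemma hasSum_integral_fC {c : ℂ} (hc0 : c ≠ 0) (hc : ‖c‖ < 1) :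
    HasSum (fun p : ℕ × ℕ => ((p.1 : ℂ) + 1) * chiThree p.2 * c ^ (p.2 * (p.1 + 1)) / p.2)
      (∫ t in (0:ℝ)..1, fC (((t : ℂ) * c) ^ 3) ^ 9 / fC ((t : ℂ) * c) ^ 3 * c) := by
  have h := intervalIntegral.hasSum_integral_of_dominated_convergence (a := 0) (b := 1)
    (μ := MeasureTheory.volume)
    (F := fun (p : ℕ × ℕ) (t : ℝ) => ((p.1 : ℂ) + 1) ^ 2 * chiThree p.2 * c ^ (p.2 * (p.1 + 1)) *
      (t : ℂ) ^ (p.2 * (p.1 + 1) - 1))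
    (f := fun t : ℝ => fC (((t : ℂ) * c) ^ 3) ^ 9 / fC ((t : ℂ) * c) ^ 3 * c)
    (fun p _ => ((p.1 : ℝ) + 1) ^ 2 * ‖c‖ ^ p.1 * ‖c‖ ^ p.2)
    (fun p => (Continuous.aestronglyMeasurable (by fun_prop)))
    (fun p => Eventually.of_forall fun t ht => ?_)
    (Eventually.of_forall fun t ht => summable_sq_mul_pow (norm_nonneg c) hc)
    intervalIntegrable_const
    (Eventually.of_forall fun t ht => ?_)
  · refine h.congr_fun fun p => ?_
    rw [intervalIntegral.integral_const_mul]
    rcases eq_or_ne p.2 0 with hm | hm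
    · simp [hm, chiThree_zero]
    · have hN : p.2 * (p.1 + 1) ≠ 0 := by positivity
      have hi : ∫ t in (0:ℝ)..1, (t : ℂ) ^ (p.2 * (p.1 + 1) - 1) =
          (((p.2 * (p.1 + 1) : ℕ) : ℂ))⁻¹ := by
        have := integral_pow (a := 0) (b := 1) (p.2 * (p.1 + 1) - 1)
        rw [Nat.sub_add_cancel (Nat.one_le_iff_ne_zero.mpr hN)] at this
        simp_rw [← Complex.ofReal_pow]
        rw [intervalIntegral.integral_ofReal, this, zero_pow hN]
        have : ((p.2 * (p.1 + 1) - 1 : ℕ) : ℝ) + 1 = ((p.2 * (p.1 + 1) : ℕ) : ℝ) := by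
          rw [Nat.cast_sub (Nat.one_le_iff_ne_zero.mpr hN)]; simp
        rw [this]; simp
      rw [hi]
      have h1 : (p.1 : ℂ) + 1 ≠ 0 := by exact_mod_cast Nat.succ_ne_zero p.1
      have h2 : (p.2 : ℂ) ≠ 0 := by exact_mod_cast hm
      push_cast; field_simp
  · rw [Set.uIoc_of_le zero_le_one] at ht
    rw [norm_mul]
    refine (mul_le_of_le_one_right (norm_nonneg _) ?_).trans
      (norm_sq_mul_chiThree_mul_pow_le hc p.1 p.2)
    rw [norm_pow, Complex.norm_real, Real.norm_of_nonneg ht.1.le]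
    exact pow_le_one₀ ht.1.le ht.2
  · rw [Set.uIoc_of_le zero_le_one] at ht
    have ht0 : (t : ℂ) ≠ 0 := by exact_mod_cast ht.1.ne'
    have hn : ‖(t : ℂ) * c‖ < 1 := by
      rw [norm_mul, Complex.norm_real, Real.norm_of_nonneg ht.1.le]
      exact mul_lt_one_of_nonneg_of_lt_one_right ht.2 (norm_nonneg _) hc
    have := (hasSum_mul_fC_cube_pow_nine_div (mul_ne_zero ht0 hc0) hn).mul_left (t : ℂ)⁻¹
    have e : (t : ℂ)⁻¹ * ((t : ℂ) * c * (fC (((t : ℂ) * c) ^ 3) ^ 9 / fC ((t : ℂ) * c) ^ 3)) =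
        fC (((t : ℂ) * c) ^ 3) ^ 9 / fC ((t : ℂ) * c) ^ 3 * c := by
      field_simp
    rw [e] at this
    refine this.congr_fun fun p => ?_
    rcases eq_or_ne p.2 0 with hm | hm
    · simp [hm, chiThree_zero]
    · have hN : p.2 * (p.1 + 1) ≠ 0 := by positivity
      obtain ⟨N, hN'⟩ := Nat.exists_eq_succ_of_ne_zero hN
      rw [hN', mul_pow, Nat.succ_sub_one, pow_succ (t : ℂ)]
      field_simp

lemma im_mul_I_pow (q : ℝ) (n : ℕ) : ((Complex.I * q) ^ n).im = chiFour n * q ^ n := by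
  have h : ((Complex.I * (q : ℂ)) ^ n).im = (Complex.I ^ n).im * q ^ n := by
    rw [mul_pow, ← Complex.ofReal_pow, Complex.im_mul_ofReal]
  rw [h, ← Nat.div_add_mod n 4]
  congr 1
  rw [pow_add, pow_mul, Complex.I_pow_four, one_pow, one_mul]
  have hlt := Nat.mod_lt n (show 0 < 4 by norm_num)
  interval_cases hn : n % 4 <;> simp [chiFour, pow_succ]

lemma chiFour_mul (m n : ℕ) : chiFour (m * n) = chiFour m * chiFour n := by
  have hm := Nat.mod_lt m (show 0 < 4 by norm_num)
  have hn := Nat.mod_lt n (show 0 < 4 by norm_num)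
  simp only [chiFour, Nat.mul_mod m n 4]
  interval_cases m % 4 <;> interval_cases n % 4 <;> rfl

lemma hasSum_im_integral_fC {q : ℝ} (hq0 : 0 < q) (hq : q < 1) :
    HasSum (fun p : ℕ × ℕ => ((p.1 : ℝ) + 1) * chiFour (p.1 + 1) *
        ((chiThree p.2 * chiFour p.2 : ℤ) / p.2) * q ^ (p.2 * (p.1 + 1)))
      (∫ t in (0:ℝ)..1, (fC (((t:ℂ)*(Complex.I*(q:ℂ)))^3)^9 / fC ((t:ℂ)*(Complex.I*(q:ℂ)))^3)
            * (Complex.I*(q:ℂ))).im := by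
  have hc0 : Complex.I * (q : ℂ) ≠ 0 := mul_ne_zero Complex.I_ne_zero (by exact_mod_cast hq0.ne')
  have hc : ‖Complex.I * (q : ℂ)‖ < 1 := by
    rwa [norm_mul, Complex.norm_I, one_mul, Complex.norm_real, Real.norm_of_nonneg hq0.le]
  refine (Complex.hasSum_im (hasSum_integral_fC hc0 hc)).congr_fun fun p => ?_
  have : ((p.1 : ℂ) + 1) * chiThree p.2 * (Complex.I * q) ^ (p.2 * (p.1 + 1)) / p.2 =
      (((p.1 + 1) * chiThree p.2 / p.2 : ℝ) : ℂ) * (Complex.I * q) ^ (p.2 * (p.1 + 1)) := by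
    push_cast; ring
  rw [this, Complex.im_ofReal_mul, im_mul_I_pow, chiFour_mul]
  push_cast; ring

/-- The theta function `∑ (-1)ⁿ e^(-(6n+1)² t) = η(12 i t / π)`. -/
noncomputable def etaTheta (t : ℝ) : ℝ := ∑' n : ℤ, (-1) ^ n * exp (-(6 * n + 1) ^ 2 * t)

lemma norm_cexp_ofReal_lt_one {r : ℝ} (hr : r < 0) : ‖Complex.exp r‖ < 1 := by
  rw [Complex.norm_exp, Complex.ofReal_re]; exact Real.exp_lt_one_iff.mpr hr

lemma cexp_mul_thetaTerm (t : ℝ) (n : ℤ) :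
    Complex.exp (-t) * thetaTerm (Complex.exp (-24 * t) ^ 3) (Complex.exp (-24 * t) ^ 2) n =
      (((-1) ^ n * exp (-(6 * n + 1) ^ 2 * t) : ℝ) : ℂ) := by
  have h2 : (2 : ℂ) * (tri n : ℂ) = n * (n - 1) := by exact_mod_cast two_mul_tri n
  rw [thetaTerm, ← Complex.exp_nat_mul, ← Complex.exp_nat_mul, ← Complex.exp_int_mul,
    ← Complex.exp_int_mul]
  push_cast
  rw [mul_assoc, ← mul_assoc (Complex.exp (-t)), mul_comm (Complex.exp (-t)), mul_assoc,
    ← Complex.exp_add, ← Complex.exp_add]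
  congr 2
  linear_combination (-36 * (t : ℂ)) * h2

lemma hasSum_etaTheta {t : ℝ} (ht : 0 < t) :
    HasSum (fun n : ℤ => (-1) ^ n * exp (-(6 * n + 1) ^ 2 * t)) (etaTheta t) := by
  refine Summable.hasSum ?_
  rw [← Complex.summable_ofReal]
  simp_rw [← cexp_mul_thetaTerm]
  refine (summable_norm_thetaTerm (pow_ne_zero _ (Complex.exp_ne_zero _)) ?_
    (pow_ne_zero _ (Complex.exp_ne_zero _))).of_norm.mul_left _
  rw [norm_pow]
  refine pow_lt_one₀ (norm_nonneg _) ?_ three_ne_zero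
  simpa using norm_cexp_ofReal_lt_one (r := -24 * t) (by linarith)

lemma ofReal_etaTheta {t : ℝ} (ht : 0 < t) :
    (etaTheta t : ℂ) = Complex.exp (-t) * fC (Complex.exp (-24 * t)) := by
  have hQ : ‖Complex.exp (-24 * t)‖ < 1 := by
    simpa using norm_cexp_ofReal_lt_one (r := -24 * t) (by linarith)
  have hQ3 : ‖Complex.exp (-24 * t) ^ 3‖ < 1 := by
    rw [norm_pow]; exact pow_lt_one₀ (norm_nonneg _) hQ three_ne_zero
  have hQ0 := Complex.exp_ne_zero (-24 * t)
  rw [etaTheta, Complex.ofReal_tsum]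
  simp_rw [← cexp_mul_thetaTerm]
  rw [tsum_mul_left, tsum_thetaTerm (pow_ne_zero _ hQ0) hQ3 (pow_ne_zero _ hQ0),
    fC_eq_mul_qPoch_cube hQ, mul_comm (qPoch _ (Complex.exp (-24 * t) ^ 2))]
  congr 4
  field_simp

/-- Splitting of the integers into the numbers `-2k` and `2k + 1`. -/
noncomputable def negEvenOddEquiv : ℤ ⊕ ℤ ≃ ℤ :=
  Equiv.ofBijective (Sum.elim (fun k => -2 * k) (fun k => 2 * k + 1)) <| by
    constructor
    · rintro (k | k) (l | l) h <;>
      simp only [Sum.elim_inl, Sum.elim_inr, Sum.inl.injEq, Sum.inr.injEq, reduceCtorEq] at h ⊢ <;>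
      omega
    · intro n
      rcases Int.emod_two_eq_zero_or_one n with h | h
      · exact ⟨Sum.inl (-(n / 2)), by simp only [Sum.elim_inl]; omega⟩
      · exact ⟨Sum.inr (n / 2), by simp only [Sum.elim_inr]; omega⟩

lemma HasSum.negEven_add_odd {f : ℤ → ℂ} {s : ℂ} (h : HasSum f s) :
    HasSum (fun k => f (-2 * k) + f (2 * k + 1)) s := by
  have h' : HasSum (f ∘ negEvenOddEquiv) s := negEvenOddEquiv.hasSum_iff.mpr h
  have h1 := (h'.summable.comp_injective Sum.inl_injective).hasSum
  have h2 := (h'.summable.comp_injective Sum.inr_injective).hasSum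
  rw [h'.unique (HasSum.sum h1 h2)]
  exact h1.add h2

/-- Jacobi's identity for the cube of Euler's product. -/
lemma hasSum_fC_pow_three {τ : ℂ} (hτ : τ.re < 0) :
    HasSum (fun k : ℤ => (4 * k + 1) * Complex.exp (k * (2 * k + 1) * τ))
      (fC (Complex.exp τ) ^ 3) := by
  have hq0 := Complex.exp_ne_zero τ
  have hq : ‖Complex.exp τ‖ < 1 := by
    rw [Complex.norm_exp]; exact Real.exp_lt_one_iff.mpr hτ
  have hS := expSummable_thetaCoeff hq0 hq
  have hd := hS.hasDerivAt isOpen_univ (z := 0) (Set.mem_univ _)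
  have hs := ((hS.mul_exponent isOpen_univ).summable_norm (z := 0) (Set.mem_univ _)).of_norm.hasSum
  have he := hd.unique (hasDerivAt_thetaExp_zero hτ)
  rw [expSeries] at he
  rw [he] at hs
  have := hs.neg.negEven_add_odd
  rw [neg_neg] at this
  refine this.congr_fun fun k => ?_
  have t1 : tri (-2 * k) = k * (2 * k + 1) := by linarith [two_mul_tri (-2 * k)]
  have t2 : tri (2 * k + 1) = k * (2 * k + 1) := by linarith [two_mul_tri (2 * k + 1)]
  have s1 : (-1 : ℂ) ^ (-2 * k) = 1 := by rw [zpow_mul]; norm_num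
  have s2 : (-1 : ℂ) ^ (2 * k + 1) = -1 := by rw [zpow_add₀ (by norm_num), zpow_mul]; norm_num
  simp only [thetaCoeff, id, t1, t2, s1, s2, ← Complex.exp_int_mul]
  push_cast
  simp only [mul_zero, Complex.exp_zero]
  ring

lemma hasSum_etaTheta_pow_three {t : ℝ} (ht : 0 < t) :
    HasSum (fun k : ℤ => (4 * k + 1) * exp (-3 * (4 * k + 1) ^ 2 * t)) (etaTheta t ^ 3) := by
  rw [← Complex.hasSum_ofReal]
  have h := (hasSum_fC_pow_three (τ := -24 * t) (by simpa using ht)).mul_left (Complex.exp (-3 * t))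
  have e : Complex.exp (-3 * t) = Complex.exp (-t) ^ 3 := by
    rw [← Complex.exp_nat_mul]; push_cast; ring_nf
  rw [Complex.ofReal_pow, ofReal_etaTheta ht, mul_pow, ← e]
  refine h.congr_fun fun k => ?_
  push_cast
  rw [mul_left_comm, ← Complex.exp_add]
  congr 2
  ring

lemma sin_two_pi_mul_quarter (n : ℕ) : Real.sin (2 * π * (1 / 4) * n) = chiFour n := by
  have h := im_mul_I_pow 1 n
  rw [one_pow, mul_one, Complex.ofReal_one, mul_one] at h
  rw [← h, ← Complex.exp_pi_div_two_mul_I, ← Complex.exp_nat_mul]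
  rw [show (n : ℂ) * (π / 2 * Complex.I) = ((2 * π * (1 / 4) * n : ℝ) : ℂ) * Complex.I by
    push_cast; ring, Complex.exp_ofReal_mul_I_im]

/-- The modular transformation of the cube of the eta function. -/
lemma hasSum_etaTheta_pow_three_inv {t : ℝ} (ht : 0 < t) :
    HasSum (fun k : ℕ => 8 * (48 * t / π) ^ (-(3 / 2) : ℝ) * ((k + 1) * chiFour (k + 1)) *
      exp (-(π ^ 2 * (k + 1) ^ 2 / 48) / t)) (etaTheta t ^ 3) := by
  have hy : 0 < 48 * t / π := by positivity
  have h1 := (HurwitzZeta.hasSum_int_oddKernel (1 / 4) hy).mul_left 4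
  have h2 : etaTheta t ^ 3 = 4 * HurwitzZeta.oddKernel ((1 / 4 : ℝ) : UnitAddCircle)
      (48 * t / π) := by
    refine (hasSum_etaTheta_pow_three ht).unique (h1.congr_fun fun k => ?_)
    rw [← mul_assoc]
    congr 2
    · ring
    · field_simp; ring
  rw [h2, HurwitzZeta.oddKernel_functional_equation]
  have h3 := (hasSum_nat_add_iff' 1).mpr
    (HurwitzZeta.hasSum_nat_sinKernel (1 / 4) (one_div_pos.mpr hy))
  simp only [Finset.range_one, Finset.sum_singleton, Nat.cast_zero, mul_zero, zero_mul,
    sub_zero, sin_two_pi_mul_quarter] at h3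
  refine ((h3.mul_left (1 / (48 * t / π) ^ (3 / 2 : ℝ))).mul_left 4).congr_fun fun k => ?_
  rw [Real.rpow_neg hy.le, one_div]
  have : -(π ^ 2 * ((k : ℝ) + 1) ^ 2 / 48) / t = -π * ((k + 1 : ℕ) : ℝ) ^ 2 *
      (1 / (48 * t / π)) := by
    push_cast; field_simp
  rw [this]
  push_cast
  ring

lemma chiThree_mul_chiFour_natAbs (n : ℤ) :
    chiThree (6 * n + 1).natAbs * chiFour (6 * n + 1).natAbs = (-1) ^ n.natAbs := by
  rw [neg_one_pow_eq_pow_mod_two]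
  unfold chiThree chiFour
  rcases Nat.mod_two_eq_zero_or_one n.natAbs with h | h <;> rw [h] <;> split_ifs <;>
    first | rfl | omega

lemma exists_of_chiThree_mul_chiFour_ne_zero {m : ℕ} (hm : chiThree m * chiFour m ≠ 0) :
    ∃ n : ℤ, (6 * n + 1).natAbs = m := by
  have : m % 6 = 1 ∨ m % 6 = 5 := by
    unfold chiThree chiFour at hm
    split_ifs at hm <;> omega
  rcases this with h | h
  · exact ⟨m / 6, by omega⟩
  · exact ⟨-(m / 6) - 1, by omega⟩

lemma hasSum_nat_etaTheta {t : ℝ} (ht : 0 < t) :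
    HasSum (fun m : ℕ => ((chiThree m * chiFour m : ℤ) : ℝ) * exp (-(m : ℝ) ^ 2 * t))
      (etaTheta t) := by
  have hinj : Function.Injective fun n : ℤ => (6 * n + 1).natAbs := fun a b h => by
    simp only at h; omega
  refine (hinj.hasSum_iff fun m hm => ?_).mp ((hasSum_etaTheta ht).congr_fun fun n => ?_)
  · by_cases h : chiThree m * chiFour m = 0
    · simp [h]
    · exact absurd (exists_of_chiThree_mul_chiFour_ne_zero h) hm
  · have h1 : (((6 * n + 1).natAbs : ℝ)) ^ 2 = (6 * n + 1) ^ 2 := by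
      rw [Nat.cast_natAbs, Int.cast_abs, sq_abs]; push_cast; ring
    have h2 : (-1 : ℝ) ^ n = (-1) ^ n.natAbs := by
      rcases Int.natAbs_eq n with h | h
      · conv_lhs => rw [h, zpow_natCast]
      · conv_lhs => rw [h, zpow_neg, zpow_natCast]
        rcases neg_one_pow_eq_or ℝ n.natAbs with e | e <;> rw [e] <;> norm_num
    simp only [Function.comp, chiThree_mul_chiFour_natAbs, h1, h2]
    push_cast; rfl

/-- The partial sums of the theta function `etaTheta`. -/
noncomputable def etaPartial (v : ℕ) (t : ℝ) : ℝ :=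
  ∑ n ∈ Finset.Icc (-(v : ℤ)) (v : ℤ), (-1) ^ n * exp (-(6 * n + 1) ^ 2 * t)

lemma tendsto_etaPartial {t : ℝ} (ht : 0 < t) :
    Tendsto (fun v => etaPartial v t) atTop (𝓝 (etaTheta t)) :=
  (hasSum_etaTheta ht).comp (Finset.tendsto_Icc_neg (R := ℤ))

lemma alternating_sum_mem_Icc (N : ℕ) : ∀ g : ℕ → ℝ, Antitone g → (∀ n, 0 ≤ g n) →
    ∑ i ∈ Finset.range N, (-1) ^ i * g i ∈ Set.Icc 0 (g 0) := by
  induction N with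
  | zero => intro g _ h0; simpa using h0 0
  | succ N ih =>
    intro g hg h0
    have h := ih (fun n => g (n + 1)) (fun a b hab => hg (by omega)) (fun n => h0 _)
    have h1 : g 1 ≤ g 0 := hg zero_le_one
    rw [Finset.sum_range_succ']
    simp only [pow_succ, mul_neg, mul_one, neg_mul, Finset.sum_neg_distrib, pow_zero, one_mul]
    simp only [zero_add] at h
    exact ⟨by linarith [h.2], by linarith [h.1]⟩

lemma sum_Icc_neg_eq (f : ℤ → ℝ) (v : ℕ) :
    ∑ n ∈ Finset.Icc (-(v : ℤ)) (v : ℤ), f n =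
      ∑ i ∈ Finset.range (v + 1), f i + ∑ i ∈ Finset.range v, f (-(i + 1)) := by
  induction v with
  | zero => simp
  | succ v ih =>
    have := Finset.sum_Icc_succ_eq_add_endpoints f (N := v)
    rw [Finset.sum_range_succ (fun i : ℕ => f i) (v + 1),
      Finset.sum_range_succ (fun i : ℕ => f (-(i + 1))) v]
    push_cast at ih this ⊢
    rw [this, ih]; ring

lemma abs_etaPartial_le (v : ℕ) {t : ℝ} (ht : 0 ≤ t) : |etaPartial v t| ≤ 2 * exp (-t) := by
  have h1 := alternating_sum_mem_Icc (v + 1) (fun n => exp (-(6 * n + 1) ^ 2 * t))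
    (fun a b hab => by
      simp only
      gcongr) (fun n => (Real.exp_pos _).le)
  have h2 := alternating_sum_mem_Icc v (fun n => exp (-(6 * n + 5) ^ 2 * t))
    (fun a b hab => by
      simp only
      gcongr) (fun n => (Real.exp_pos _).le)
  have h3 : exp (-(6 * ((0 : ℕ) : ℝ) + 5) ^ 2 * t) ≤ exp (-t) := by
    rw [Real.exp_le_exp]; norm_num; linarith
  have h4 : exp (-(6 * ((0 : ℕ) : ℝ) + 1) ^ 2 * t) = exp (-t) := by norm_num
  rw [h4] at h1
  have e : etaPartial v t = ∑ i ∈ Finset.range (v + 1), (-1) ^ i * exp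
      (-(6 * (i : ℝ) + 1) ^ 2 * t) -
      ∑ i ∈ Finset.range v, (-1) ^ i * exp (-(6 * (i : ℝ) + 5) ^ 2 * t) := by
    rw [etaPartial, sum_Icc_neg_eq, sub_eq_add_neg, ← Finset.sum_neg_distrib]
    congr 1
    refine Finset.sum_congr rfl fun i _ => ?_
    have s : (-1 : ℝ) ^ (-((i : ℤ) + 1)) = -(-1) ^ i := by
      rw [zpow_neg, zpow_add_one₀ (by norm_num), zpow_natCast]
      rcases neg_one_pow_eq_or ℝ i with e | e <;> rw [e] <;> norm_num
    rw [s]; push_cast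
    rw [show (6 * -((i : ℝ) + 1) + 1) ^ 2 = (6 * (i : ℝ) + 5) ^ 2 by ring]
    ring_nf
  rw [e, abs_le]
  have := Real.exp_pos (-t)
  exact ⟨by linarith [h1.1, h2.2], by linarith [h1.2, h2.1]⟩

lemma integral_mul_exp_neg {Q : ℝ} (hQ : 0 < Q) :
    ∫ t in Set.Ioi (0 : ℝ), t * exp (-(Q * t)) = 1 / Q ^ 2 := by
  have h := Real.integral_rpow_mul_exp_neg_mul_Ioi two_pos hQ
  norm_num at h
  simpa using h

lemma integrableOn_mul_exp_neg {Q : ℝ} (hQ : 0 < Q) :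
    MeasureTheory.IntegrableOn (fun t : ℝ => t * exp (-(Q * t))) (Set.Ioi 0) :=
  MeasureTheory.Integrable.of_integral_ne_zero (by rw [integral_mul_exp_neg hQ]; positivity)

lemma integrable_and_integral_sum {α ι : Type*} [MeasurableSpace α] {μ : MeasureTheory.Measure α}
    (s : Finset ι) {f : ι → α → ℝ} {I : ι → ℝ}
    (h : ∀ i, MeasureTheory.Integrable (f i) μ ∧ ∫ a, f i a ∂μ = I i) :
    MeasureTheory.Integrable (fun a => ∑ i ∈ s, f i a) μ ∧
      ∫ a, ∑ i ∈ s, f i a ∂μ = ∑ i ∈ s, I i := by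
  refine ⟨MeasureTheory.integrable_finsetSum s fun i _ => (h i).1, ?_⟩
  rw [MeasureTheory.integral_finsetSum s fun i _ => (h i).1]
  exact Finset.sum_congr rfl fun i _ => (h i).2

lemma boxSum_eq_integral (x : ℝ) (v : ℕ) :
    boxSum 1 1 1 (x ^ 2) v =
      ∫ t in Set.Ioi (0 : ℝ), t * etaPartial v t ^ 3 * etaPartial v (x ^ 2 * t) := by
  rw [boxSum]
  set s := Finset.Icc (-(v : ℤ)) (v : ℤ) with hs
  have h : ∀ n₁ n₂ n₃ n₄ : ℤ,
      MeasureTheory.Integrable (fun t : ℝ => t * ((-1) ^ n₁ * exp (-(6 * n₁ + 1) ^ 2 * t)) *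
        ((-1) ^ n₂ * exp (-(6 * n₂ + 1) ^ 2 * t)) * ((-1) ^ n₃ * exp (-(6 * n₃ + 1) ^ 2 * t)) *
        ((-1) ^ n₄ * exp (-(6 * n₄ + 1) ^ 2 * (x ^ 2 * t))))
          (MeasureTheory.volume.restrict (Set.Ioi 0)) ∧
      ∫ t in Set.Ioi (0 : ℝ), t * ((-1) ^ n₁ * exp (-(6 * n₁ + 1) ^ 2 * t)) *
        ((-1) ^ n₂ * exp (-(6 * n₂ + 1) ^ 2 * t)) * ((-1) ^ n₃ * exp (-(6 * n₃ + 1) ^ 2 * t)) *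
        ((-1) ^ n₄ * exp (-(6 * n₄ + 1) ^ 2 * (x ^ 2 * t))) =
      (-1:ℝ)^(n₁+n₂+n₃+n₄) /
        (1*((6*n₁+1:ℤ):ℝ)^2 + 1*((6*n₂+1:ℤ):ℝ)^2 + 1*((6*n₃+1:ℤ):ℝ)^2 +
          x^2*((6*n₄+1:ℤ):ℝ)^2)^2 := by
    intro n₁ n₂ n₃ n₄
    set Q : ℝ := 1*((6*n₁+1:ℤ):ℝ)^2 + 1*((6*n₂+1:ℤ):ℝ)^2 + 1*((6*n₃+1:ℤ):ℝ)^2 +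
      x^2*((6*n₄+1:ℤ):ℝ)^2 with hQ
    have hQ0 : 0 < Q := by
      have : ((6*n₁+1:ℤ):ℝ) ≠ 0 := by
        have : (6*n₁+1:ℤ) ≠ 0 := by omega
        exact_mod_cast this
      positivity
    have e : (fun t : ℝ => t * ((-1) ^ n₁ * exp (-(6 * n₁ + 1) ^ 2 * t)) *
        ((-1) ^ n₂ * exp (-(6 * n₂ + 1) ^ 2 * t)) * ((-1) ^ n₃ * exp (-(6 * n₃ + 1) ^ 2 * t)) *
        ((-1) ^ n₄ * exp (-(6 * n₄ + 1) ^ 2 * (x ^ 2 * t)))) =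
        fun t : ℝ => (-1) ^ (n₁ + n₂ + n₃ + n₄) * (t * exp (-(Q * t))) := by
      funext t
      have e1 : -(Q * t) = -(6 * n₁ + 1) ^ 2 * t + -(6 * n₂ + 1) ^ 2 * t +
          -(6 * n₃ + 1) ^ 2 * t + -(6 * n₄ + 1) ^ 2 * (x ^ 2 * t) := by
        rw [hQ]; push_cast; ring
      have hne : (-1 : ℝ) ≠ 0 := by norm_num
      rw [e1, Real.exp_add, Real.exp_add, Real.exp_add, zpow_add₀ hne, zpow_add₀ hne, zpow_add₀ hne]
      ring
    rw [e]
    refine ⟨(integrableOn_mul_exp_neg hQ0).const_mul _, ?_⟩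
    rw [MeasureTheory.integral_const_mul, integral_mul_exp_neg hQ0, mul_one_div]
  have hsum := (integrable_and_integral_sum s fun n₁ => integrable_and_integral_sum s fun n₂ =>
    integrable_and_integral_sum s fun n₃ => integrable_and_integral_sum s fun n₄ => h n₁ n₂ n₃ n₄).2
  rw [← hsum]
  congr 1
  funext t
  simp only [etaPartial, ← hs, ← Finset.mul_sum, ← Finset.sum_mul]
  ring

/-- The box sums converge to a Mellin-type integral of theta functions. -/
lemma tendsto_boxSum {x : ℝ} (hx : 0 < x) :
    Tendsto (fun v => boxSum 1 1 1 (x ^ 2) v) atTop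
      (𝓝 (∫ t in Set.Ioi (0 : ℝ), t * etaTheta t ^ 3 * etaTheta (x ^ 2 * t))) := by
  simp_rw [boxSum_eq_integral]
  refine MeasureTheory.tendsto_integral_of_dominated_convergence
    (fun t => 16 * (t * exp (-((3 + x ^ 2) * t)))) (fun v => ?_)
    ((integrableOn_mul_exp_neg (by positivity)).const_mul 16) (fun v => ?_) ?_
  · refine Continuous.aestronglyMeasurable ?_
    unfold etaPartial
    fun_prop
  · refine (MeasureTheory.ae_restrict_iff' measurableSet_Ioi).mpr
      (Eventually.of_forall fun t ht => ?_)
    have ht' : 0 < t := ht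
    have h1 := abs_etaPartial_le v ht'.le
    have h2 := abs_etaPartial_le v (t := x ^ 2 * t) (by positivity)
    rw [norm_mul, norm_mul, norm_pow, Real.norm_of_nonneg ht'.le, Real.norm_eq_abs,
      Real.norm_eq_abs]
    calc t * |etaPartial v t| ^ 3 * |etaPartial v (x ^ 2 * t)|
        ≤ t * (2 * exp (-t)) ^ 3 * (2 * exp (-(x ^ 2 * t))) := by gcongr
      _ = 16 * (t * (exp (-t) ^ 3 * exp (-(x ^ 2 * t)))) := by ring
      _ = _ := by
        rw [← Real.exp_nat_mul, ← Real.exp_add]; congr 3; push_cast; ring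
  · refine (MeasureTheory.ae_restrict_iff' measurableSet_Ioi).mpr
      (Eventually.of_forall fun t ht => ?_)
    have ht' : 0 < t := ht
    exact ((tendsto_etaPartial ht').pow 3).const_mul t |>.mul (tendsto_etaPartial (by positivity))

/-- The primitive of the Gaussian `e^(-u²)` vanishing at the origin. -/
noncomputable def gaussPrimitive (y : ℝ) : ℝ := ∫ u in (0:ℝ)..y, exp (-u ^ 2)

lemma hasDerivAt_gaussPrimitive (y : ℝ) : HasDerivAt gaussPrimitive (exp (-y ^ 2)) y :=
  (by fun_prop : Continuous fun u : ℝ => exp (-u ^ 2)).integral_hasStrictDerivAt 0 y |>.hasDerivAt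

lemma gaussPrimitive_neg (y : ℝ) : gaussPrimitive (-y) = -gaussPrimitive y := by
  have := intervalIntegral.integral_comp_neg (a := 0) (b := y) (fun u : ℝ => exp (-u ^ 2))
  simp only [even_two.neg_pow, neg_zero] at this
  rw [gaussPrimitive, gaussPrimitive, this, intervalIntegral.integral_symm]

lemma tendsto_gaussPrimitive_atTop : Tendsto gaussPrimitive atTop (𝓝 (√π / 2)) := by
  have h := integral_gaussian_Ioi 1
  have hi := (integrable_exp_neg_mul_sq one_pos).integrableOn (s := Set.Ioi 0)
  simp only [neg_mul, one_mul, div_one] at h hi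
  rw [← h]
  exact MeasureTheory.intervalIntegral_tendsto_integral_Ioi 0 hi tendsto_id

lemma tendsto_gaussPrimitive_atBot : Tendsto gaussPrimitive atBot (𝓝 (-(√π / 2))) := by
  have := (tendsto_gaussPrimitive_atTop.comp tendsto_neg_atBot_atTop).neg
  refine this.congr fun y => ?_
  simp [gaussPrimitive_neg]

/-- A primitive of `t^(-1/2) e^(-α²t - β²/t)` on the positive half-line. -/
noncomputable def besselPrimitive (α β t : ℝ) : ℝ :=
  α⁻¹ * (exp (-(2 * α * β)) * gaussPrimitive (α * √t - β * (√t)⁻¹) +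
    exp (2 * α * β) * gaussPrimitive (α * √t + β * (√t)⁻¹))

lemma hasDerivAt_besselPrimitive {α : ℝ} (hα : 0 < α) (β : ℝ) {t : ℝ} (ht : 0 < t) :
    HasDerivAt (besselPrimitive α β) ((√t)⁻¹ * exp (-(α ^ 2 * t) - β ^ 2 / t)) t := by
  have hs : 0 < √t := Real.sqrt_pos.mpr ht
  have h1 := Real.hasDerivAt_sqrt ht.ne'
  have h2 := h1.inv hs.ne'
  have h3 := ((hasDerivAt_gaussPrimitive (α * √t - β * (√t)⁻¹)).comp t
    ((h1.const_mul α).sub (h2.const_mul β))).const_mul (exp (-(2 * α * β)))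
  have h4 := ((hasDerivAt_gaussPrimitive (α * √t + β * (√t)⁻¹)).comp t
    ((h1.const_mul α).add (h2.const_mul β))).const_mul (exp (2 * α * β))
  refine ((h3.add h4).const_mul α⁻¹).congr_deriv ?_
  have hst : √t ^ 2 = t := Real.sq_sqrt ht.le
  have e1 : exp (-(2 * α * β)) * exp (-(α * √t - β * (√t)⁻¹) ^ 2) =
      exp (-(α ^ 2 * t) - β ^ 2 / t) := by
    rw [← Real.exp_add]; congr 1
    rw [← hst, Real.sqrt_sq hs.le]; field_simp; ring
  have e2 : exp (2 * α * β) * exp (-(α * √t + β * (√t)⁻¹) ^ 2) =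
      exp (-(α ^ 2 * t) - β ^ 2 / t) := by
    rw [← Real.exp_add]; congr 1
    rw [← hst, Real.sqrt_sq hs.le]; field_simp; ring
  rw [← mul_assoc, ← mul_assoc, e1, e2]
  field_simp
  ring

lemma integral_bessel {α β : ℝ} (hα : 0 < α) (hβ : 0 < β) :
    MeasureTheory.IntegrableOn (fun t => (√t)⁻¹ * exp (-(α ^ 2 * t) - β ^ 2 / t)) (Set.Ioi 0) ∧
    ∫ t in Set.Ioi (0:ℝ), (√t)⁻¹ * exp (-(α ^ 2 * t) - β ^ 2 / t) =
      √π / α * exp (-(2 * α * β)) := by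
  have hinf : Tendsto (besselPrimitive α β) atTop
      (𝓝 (α⁻¹ * (exp (-(2 * α * β)) * (√π / 2) + exp (2 * α * β) * (√π / 2)))) := by
    have h1 : Tendsto (fun t : ℝ => α * √t) atTop atTop :=
      Real.tendsto_sqrt_atTop.const_mul_atTop hα
    have h2 : Tendsto (fun t : ℝ => β * (√t)⁻¹) atTop (𝓝 (β * 0)) :=
      (tendsto_inv_atTop_zero.comp Real.tendsto_sqrt_atTop).const_mul β
    exact (((tendsto_gaussPrimitive_atTop.comp (h1.atTop_add h2.neg)).const_mul _).add
      ((tendsto_gaussPrimitive_atTop.comp (h1.atTop_add h2)).const_mul _)).const_mul _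
  have hzero : Tendsto (besselPrimitive α β) (𝓝[>] 0)
      (𝓝 (α⁻¹ * (exp (-(2 * α * β)) * (-(√π / 2)) + exp (2 * α * β) * (√π / 2)))) := by
    have hs : Tendsto (fun t : ℝ => √t) (𝓝[>] 0) (𝓝[>] 0) := by
      refine tendsto_nhdsWithin_iff.mpr ⟨?_, ?_⟩
      · have := (Real.continuous_sqrt.tendsto 0).mono_left (nhdsWithin_le_nhds (s := Set.Ioi 0))
        simpa using this
      · filter_upwards [self_mem_nhdsWithin] with t ht using Real.sqrt_pos.mpr ht
    have h1 : Tendsto (fun t : ℝ => α * √t) (𝓝[>] 0) (𝓝 (α * 0)) :=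
      (hs.mono_right nhdsWithin_le_nhds).const_mul α
    have h2 : Tendsto (fun t : ℝ => β * (√t)⁻¹) (𝓝[>] 0) atTop :=
      (tendsto_inv_nhdsGT_zero.comp hs).const_mul_atTop hβ
    exact (((tendsto_gaussPrimitive_atBot.comp
      (h1.add_atBot (tendsto_neg_atTop_atBot.comp h2))).const_mul _).add
      ((tendsto_gaussPrimitive_atTop.comp (h1.add_atTop h2)).const_mul _)).const_mul _
  set l₀ := α⁻¹ * (exp (-(2 * α * β)) * (-(√π / 2)) + exp (2 * α * β) * (√π / 2)) with hl₀
  have hcont : ContinuousWithinAt (Function.update (besselPrimitive α β) 0 l₀) (Set.Ici 0) 0 := by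
    rw [continuousWithinAt_update_same]
    exact hzero.mono_left (nhdsWithin_mono _ fun y hy => lt_of_le_of_ne hy.1 (Ne.symm hy.2))
  have hev : ∀ t : ℝ, t ≠ 0 →
      Function.update (besselPrimitive α β) 0 l₀ =ᶠ[𝓝 t] besselPrimitive α β := fun t ht => by
    filter_upwards [isOpen_ne.mem_nhds ht] with y hy
    exact Function.update_of_ne hy _ _
  have hderiv : ∀ t ∈ Set.Ioi (0:ℝ), HasDerivAt (Function.update (besselPrimitive α β) 0 l₀)
      ((√t)⁻¹ * exp (-(α ^ 2 * t) - β ^ 2 / t)) t := fun t ht =>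
    (hasDerivAt_besselPrimitive hα β ht).congr_of_eventuallyEq (hev t (ne_of_gt ht))
  have hlim : Tendsto (Function.update (besselPrimitive α β) 0 l₀) atTop
      (𝓝 (α⁻¹ * (exp (-(2 * α * β)) * (√π / 2) + exp (2 * α * β) * (√π / 2)))) := by
    refine hinf.congr' ?_
    filter_upwards [eventually_gt_atTop 0] with t ht
    exact (Function.update_of_ne ht.ne' _ _).symm
  have hnn : ∀ t ∈ Set.Ioi (0:ℝ), 0 ≤ (√t)⁻¹ * exp (-(α ^ 2 * t) - β ^ 2 / t) :=
    fun t _ => by positivity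
  refine ⟨MeasureTheory.integrableOn_Ioi_deriv_of_nonneg hcont hderiv hnn hlim, ?_⟩
  rw [MeasureTheory.integral_Ioi_of_hasDerivAt_of_nonneg hcont hderiv hnn hlim,
    Function.update_self, hl₀]
  field_simp
  ring

lemma mul_rpow_neg_three_halves {t : ℝ} (ht : 0 < t) :
    t * (48 * t / π) ^ (-(3 / 2) : ℝ) = (48 / π) ^ (-(3 / 2) : ℝ) * (√t)⁻¹ := by
  rw [show 48 * t / π = 48 / π * t by ring, Real.mul_rpow (by positivity) ht.le, mul_left_comm]
  congr 1
  rw [Real.sqrt_eq_rpow, ← Real.rpow_neg ht.le]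
  nth_rewrite 1 [← Real.rpow_one t]
  rw [← Real.rpow_add ht]
  norm_num

lemma rpow_neg_three_halves_mul_sqrt_pi :
    8 * (48 / π) ^ (-(3 / 2) : ℝ) * √π = π ^ 2 / (24 * √3) := by
  have h : (48 / π : ℝ) ^ (-(3 / 2) : ℝ) = (48 / π * √(48 / π))⁻¹ := by
    rw [Real.rpow_neg (by positivity), Real.sqrt_eq_rpow]
    nth_rewrite 2 [← Real.rpow_one (48 / π)]
    rw [← Real.rpow_add (by positivity)]
    norm_num
  have h48 : √48 = 4 * √3 := by
    rw [show (48 : ℝ) = 4 ^ 2 * 3 by norm_num, Real.sqrt_mul (by norm_num), Real.sqrt_sq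
      (by norm_num)]
  rw [h, Real.sqrt_div (by norm_num), h48]
  have h1 : √π ^ 2 = π := Real.sq_sqrt pi_pos.le
  have h2 : 0 < √π := Real.sqrt_pos.mpr pi_pos
  field_simp
  rw [h1]
  ring

/-- Termwise integration of the product of theta functions. -/
lemma integral_etaTheta {x q I : ℝ} (hx : 0 < x) (hq : q = exp (-π * x / √12))
    (hI : HasSum (fun p : ℕ × ℕ => ((p.1 : ℝ) + 1) * chiFour (p.1 + 1) *
        ((chiThree p.2 * chiFour p.2 : ℤ) / p.2) * q ^ (p.2 * (p.1 + 1))) I) :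
    ∫ t in Set.Ioi (0 : ℝ), t * etaTheta t ^ 3 * etaTheta (x ^ 2 * t) =
      π ^ 2 / (24 * √3 * x) * I := by
  set C : ℝ := 8 * (48 / π) ^ (-(3 / 2) : ℝ) with hC
  have hC0 : 0 ≤ C := by positivity
  set K : ℝ := C * √π / x with hK
  set f : ℕ × ℕ → ℝ := fun p => ((p.1 : ℝ) + 1) * chiFour (p.1 + 1) *
        ((chiThree p.2 * chiFour p.2 : ℤ) / p.2) * q ^ (p.2 * (p.1 + 1)) with hf
  set a : ℕ × ℕ → ℝ := fun p =>
    ((p.1 : ℝ) + 1) * chiFour (p.1 + 1) * (chiThree p.2 * chiFour p.2 : ℤ) with ha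
  set g : ℕ × ℕ → ℝ → ℝ := fun p t => (√t)⁻¹ *
    exp (-((p.2 * x) ^ 2 * t) - (π * (p.1 + 1) / √48) ^ 2 / t) with hg
  have hg0 : ∀ p t, 0 ≤ g p t := fun p t => by positivity
  have h48 : √48 = 2 * √12 := by
    rw [show (48 : ℝ) = 2 ^ 2 * 12 by norm_num, Real.sqrt_mul (by norm_num), Real.sqrt_sq
      (by norm_num)]
  have hgi : ∀ p : ℕ × ℕ, p.2 ≠ 0 → MeasureTheory.IntegrableOn (g p) (Set.Ioi 0) ∧
      ∫ t in Set.Ioi (0:ℝ), g p t = √π / (p.2 * x) * q ^ (p.2 * (p.1 + 1)) := by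
    intro p hp
    have hp' : (0 : ℝ) < p.2 := by exact_mod_cast Nat.pos_of_ne_zero hp
    have h := integral_bessel (α := p.2 * x) (β := π * (p.1 + 1) / √48) (by positivity)
      (by positivity)
    refine ⟨h.1, h.2.trans ?_⟩
    rw [hq, ← Real.exp_nat_mul, h48]
    congr 2
    push_cast; field_simp
  have hzero : ∀ p : ℕ × ℕ, p.2 = 0 → a p = 0 := fun p hp => by simp [ha, hp, chiThree_zero]
  have hfa : ∀ p : ℕ × ℕ, p.2 ≠ 0 → C * |a p| * (√π / (p.2 * x) * q ^ (p.2 * (p.1 + 1))) =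
      K * |f p| ∧ C * a p * (√π / (p.2 * x) * q ^ (p.2 * (p.1 + 1))) = K * f p := by
    intro p hp
    have hp' : (0 : ℝ) < p.2 := by exact_mod_cast Nat.pos_of_ne_zero hp
    have hq0 : 0 < q := by rw [hq]; exact Real.exp_pos _
    have : f p = a p * (q ^ (p.2 * (p.1 + 1)) / p.2) := by simp only [hf, ha]; ring
    have habs : |f p| = |a p| * (q ^ (p.2 * (p.1 + 1)) / p.2) := by
      rw [this, abs_mul (a p), abs_of_pos (a := q ^ (p.2 * (p.1 + 1)) / (p.2 : ℝ)) (by positivity)]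
    refine ⟨?_, ?_⟩
    · rw [habs, hK]; field_simp
    · rw [this, hK]; field_simp
  have hFint : ∀ p, MeasureTheory.IntegrableOn (fun t => C * a p * g p t) (Set.Ioi 0) := by
    intro p
    rcases eq_or_ne p.2 0 with hp | hp
    · simp [hzero p hp]
    · exact (hgi p hp).1.const_mul _
  have hFval : ∀ p, ∫ t in Set.Ioi (0:ℝ), C * a p * g p t = K * f p := by
    intro p
    rcases eq_or_ne p.2 0 with hp | hp
    · simp [hzero p hp, hf, hp]
    · rw [MeasureTheory.integral_const_mul, (hgi p hp).2, (hfa p hp).2]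
  have hFnorm : ∀ p, ∫ t in Set.Ioi (0:ℝ), ‖C * a p * g p t‖ = K * |f p| := by
    intro p
    have : ∀ t, ‖C * a p * g p t‖ = C * |a p| * g p t := fun t => by
      rw [Real.norm_eq_abs, abs_mul, abs_mul, abs_of_nonneg hC0, abs_of_nonneg (hg0 p t)]
    simp_rw [this]
    rcases eq_or_ne p.2 0 with hp | hp
    · simp [hzero p hp, hf, hp]
    · rw [MeasureTheory.integral_const_mul, (hgi p hp).2, (hfa p hp).1]
  have hsum := MeasureTheory.hasSum_integral_of_summable_integral_norm hFint
    (by simp_rw [hFnorm]; exact hI.summable.abs.mul_left K)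
  simp_rw [hFval] at hsum
  have hKI := hsum.unique (hI.mul_left K)
  have hpt : ∀ t ∈ Set.Ioi (0:ℝ), t * etaTheta t ^ 3 * etaTheta (x ^ 2 * t) =
      ∑' p, C * a p * g p t := by
    intro t ht
    have ht' : 0 < t := ht
    have h1 := (hasSum_etaTheta_pow_three_inv ht').mul_left t
    have h2 := hasSum_nat_etaTheta (t := x ^ 2 * t) (by positivity)
    have h3 := h1.mul h2 (summable_mul_of_summable_norm h1.summable.norm h2.summable.norm)
    rw [← h3.tsum_eq]
    refine tsum_congr fun p => ?_
    have e : exp (-(π ^ 2 * ((p.1 : ℝ) + 1) ^ 2 / 48) / t) * exp (-(p.2 : ℝ) ^ 2 * (x ^ 2 * t)) =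
        exp (-((p.2 * x) ^ 2 * t) - (π * (p.1 + 1) / √48) ^ 2 / t) := by
      rw [← Real.exp_add, div_pow, Real.sq_sqrt (by norm_num)]; congr 1; ring
    simp only [hg, ha, hC]
    rw [← e]
    linear_combination 8 * (((p.1 : ℝ) + 1) * chiFour (p.1 + 1)) *
      exp (-(π ^ 2 * ((p.1 : ℝ) + 1) ^ 2 / 48) / t) *
      (((chiThree p.2 * chiFour p.2 : ℤ) : ℝ) * exp (-(p.2 : ℝ) ^ 2 * (x ^ 2 * t))) *
      mul_rpow_neg_three_halves ht'
  rw [MeasureTheory.setIntegral_congr_fun measurableSet_Ioi hpt, hKI, hK, hC,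
    rpow_neg_three_halves_mul_sqrt_pi, div_div]

/-- For `x > 0`, with `q = e^{-πx/√12}`,
`F(1,1,1,x²)/(3+x²)² = (π²/(24√3 x)) Im ∫₀^{iq} f(-u³)⁹/f(-u)³ du`,
the integral being over the straight segment from `0` to `iq`.
(Note `F(1,1,1,x²)/(3+x²)²` is exactly the limit of the box sums.) -/
theorem stmt_6 (x : ℝ) (hx : 0 < x) (q : ℝ) (hq : q = Real.exp (-π*x/Real.sqrt 12)) :
    Tendsto (fun v => boxSum 1 1 1 (x^2) v) atTop
      (𝓝 (π^2/(24*Real.sqrt 3*x) *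
        (∫ t in (0:ℝ)..1,
          (fC (((t:ℂ)*(Complex.I*(q:ℂ)))^3)^9 / fC ((t:ℂ)*(Complex.I*(q:ℂ)))^3)
            * (Complex.I*(q:ℂ))).im)) := by
  have hq0 : 0 < q := by rw [hq]; exact Real.exp_pos _
  have hq1 : q < 1 := by
    rw [hq, Real.exp_lt_one_iff, neg_mul, neg_div, neg_lt_zero]
    positivity
  rw [← integral_etaTheta hx hq (hasSum_im_integral_fC hq0 hq1)]
  exact tendsto_boxSum hx
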